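/- arXiv:2005.01490 — 3 statements merged into one kernel-verified Lean document; each statement's English description precedes it below -/
import Mathlib

section
/- Let ε > 0. For Lebesgue-almost all α ∈ [0,1] the following holds: for every δ > 0 there exists N₀ (depending on α, ε, δ) such that for every integer N ≥ N₀ and every real L with N^(1/4+ε) < L ≤ N one has |∫₀¹ W(α,L,N,y)³ dy − L³| ≤ δ·L³. -/
open MeasureTheory

/-- The counting function `W(α,L,N,y)`: the number of integers `1 ≤ n ≤ N` such that
the fractional part of `α·n² − y` is at most `L/N`. -/
noncomputable def W (α L : ℝ) (N : ℕ) (y : ℝ) : ℝ :=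
  ((Finset.Icc 1 N).filter (fun n : ℕ => Int.fract (α * (n : ℝ)^2 - y) ≤ L / N)).card

/-- The centred indicator of the arc `[0, s]` of the circle, as a `1`-periodic function. -/
noncomputable def centredArc (s x : ℝ) : ℝ := (if Int.fract x ≤ s then 1 else 0) - s

theorem centredArc_periodic (s : ℝ) : Function.Periodic (centredArc s) 1 := fun x => by
  simp [centredArc]

theorem measurable_centredArc (s : ℝ) : Measurable (centredArc s) :=
  (Measurable.ite (measurableSet_le measurable_fract measurable_const)
    measurable_const measurable_const).sub_const s

theorem abs_centredArc_le {s : ℝ} (hs : 0 ≤ s) (hs1 : s ≤ 1) (x : ℝ) :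
    |centredArc s x| ≤ 1 := by
  unfold centredArc
  split_ifs <;> rw [abs_le] <;> constructor <;> linarith

theorem intervalIntegrable_of_abs_le {f : ℝ → ℝ} (hf : Measurable f) {C : ℝ}
    (hC : ∀ x, |f x| ≤ C) (a b : ℝ) : IntervalIntegrable f volume a b :=
  (intervalIntegrable_const (c := C)).mono_fun hf.aestronglyMeasurable
    (Filter.Eventually.of_forall fun x => by
      simpa using (hC x).trans (le_abs_self C))

theorem intervalIntegrable_centredArc {s : ℝ} (hs : 0 ≤ s) (hs1 : s ≤ 1) (a b : ℝ) :
    IntervalIntegrable (centredArc s) volume a b :=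
  intervalIntegrable_of_abs_le (measurable_centredArc s) (abs_centredArc_le hs hs1) a b

theorem integral_centredArc {s : ℝ} (hs : 0 ≤ s) (hs1 : s ≤ 1) :
    ∫ x in (0:ℝ)..1, centredArc s x = 0 := by
  have hint := intervalIntegrable_centredArc hs hs1
  rw [← intervalIntegral.integral_add_adjacent_intervals (hint 0 s) (hint s 1)]
  have h1 : ∫ x in (0:ℝ)..s, centredArc s x = ∫ x in (0:ℝ)..s, (1 - s) := by
    apply intervalIntegral.integral_congr_Ioo_of_le hs
    intro x hx
    have : Int.fract x = x := Int.fract_eq_self.2 ⟨hx.1.le, hx.2.trans_le hs1⟩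
    simp [centredArc, this, hx.2.le]
  have h2 : ∫ x in s..1, centredArc s x = ∫ x in s..1, (-s) := by
    apply intervalIntegral.integral_congr_Ioo_of_le hs1
    intro x hx
    have : Int.fract x = x := Int.fract_eq_self.2 ⟨hs.trans hx.1.le, hx.2⟩
    simp [centredArc, this, hx.1]
  rw [h1, h2]
  simp
  ring

theorem integral_centredArc_sq_le {s : ℝ} (hs : 0 ≤ s) (hs1 : s ≤ 1) :
    ∫ x in (0:ℝ)..1, centredArc s x ^ 2 ≤ s := by
  have h : ∀ x, centredArc s x ^ 2 = (1 - 2 * s) * centredArc s x + (s - s ^ 2) := by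
    intro x
    unfold centredArc
    split_ifs <;> ring
  simp_rw [h]
  rw [intervalIntegral.integral_add ((intervalIntegrable_centredArc hs hs1 0 1).const_mul _)
    intervalIntegrable_const, intervalIntegral.integral_const_mul, integral_centredArc hs hs1]
  simp
  positivity

/-- The integral over a period of a periodic function is invariant under reflection and
translation. -/
theorem Function.Periodic.integral_comp_const_sub {f : ℝ → ℝ} (hf : Function.Periodic f 1)
    (c : ℝ) : ∫ y in (0:ℝ)..1, f (c - y) = ∫ y in (0:ℝ)..1, f y := by
  rw [intervalIntegral.integral_comp_sub_left]
  have := hf.intervalIntegral_add_eq (c - 1) 0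
  simpa using this

theorem Function.Periodic.integral_comp_add_intCast_mul {f : ℝ → ℝ}
    (hf : Function.Periodic f 1) (hint : ∀ a b, IntervalIntegrable f volume a b)
    (z : ℝ) {c : ℤ} (hc : c ≠ 0) :
    ∫ x in (0:ℝ)..1, f (z + x * c) = ∫ x in (0:ℝ)..1, f x := by
  have hc' : (c : ℝ) ≠ 0 := by exact_mod_cast hc
  have h := hf.intervalIntegral_add_zsmul_eq c z hint
  simp_rw [mul_comm _ (c : ℝ)]
  rw [intervalIntegral.integral_comp_add_mul _ hc']
  simp only [zsmul_eq_mul, mul_one] at h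
  simp only [mul_zero, add_zero, mul_one, smul_eq_mul, h]
  rw [hf.intervalIntegral_add_eq z 0, zero_add]
  field_simp

/-- For distinct integers `a`, `b`, the points `αa - y` and `αb - y` are uncorrelated. -/
theorem integral_centredArc_mul_eq_zero {s : ℝ} (hs : 0 ≤ s) (hs1 : s ≤ 1) {a b : ℤ}
    (hab : a ≠ b) :
    ∫ α in (0:ℝ)..1, ∫ y in (0:ℝ)..1,
      centredArc s (α * a - y) * centredArc s (α * b - y) = 0 := by
  have hinner : ∀ α : ℝ, ∫ y in (0:ℝ)..1, centredArc s (α * a - y) * centredArc s (α * b - y)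
      = ∫ z in (0:ℝ)..1, centredArc s z * centredArc s (z + α * ((b - a : ℤ) : ℝ)) := by
    intro α
    have hper : Function.Periodic
        (fun z => centredArc s z * centredArc s (z + α * ((b - a : ℤ) : ℝ))) 1 := by
      intro z
      have h1 := centredArc_periodic s z
      have h2 := centredArc_periodic s (z + α * ((b - a : ℤ) : ℝ))
      simp only [h1, add_right_comm z 1, h2]
    rw [← hper.integral_comp_const_sub (α * a)]
    congr 1
    ext y
    congr 2
    push_cast
    ring
  simp_rw [hinner]
  have hm := measurable_centredArc s
  simp_rw [intervalIntegral.integral_of_le zero_le_one]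
  rw [integral_integral_swap]
  · simp_rw [← intervalIntegral.integral_of_le (zero_le_one (α := ℝ)),
      intervalIntegral.integral_const_mul]
    simp_rw [(centredArc_periodic s).integral_comp_add_intCast_mul
      (intervalIntegrable_centredArc hs hs1) _ (sub_ne_zero.2 hab.symm),
      integral_centredArc hs hs1]
    simp
  · refine Integrable.of_bound (C := 1) (Measurable.aestronglyMeasurable ?_)
      (Filter.Eventually.of_forall fun p => ?_)
    · unfold Function.uncurry
      fun_prop
    · simp only [Function.uncurry, norm_mul, Real.norm_eq_abs]
      exact mul_le_one₀ (abs_centredArc_le hs hs1 _) (abs_nonneg _) (abs_centredArc_le hs hs1 _)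

theorem W_sub_eq_sum (α L : ℝ) {N : ℕ} (hN : 0 < N) (y : ℝ) :
    W α L N y - L = ∑ n ∈ Finset.Icc 1 N, centredArc (L / N) (α * (n : ℝ) ^ 2 - y) := by
  have : (N : ℝ) ≠ 0 := by positivity
  simp only [centredArc, Finset.sum_sub_distrib, W, Finset.card_filter]
  push_cast
  simp
  field_simp

theorem measurable_W (L : ℝ) (N : ℕ) : Measurable (fun p : ℝ × ℝ => W p.1 L N p.2) := by
  have : ∀ p : ℝ × ℝ, W p.1 L N p.2 = ∑ n ∈ Finset.Icc 1 N,
      if Int.fract (p.1 * (n : ℝ) ^ 2 - p.2) ≤ L / N then (1 : ℝ) else 0 := by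
    intro p
    rw [W, Finset.card_filter]
    push_cast
    rfl
  simp_rw [this]
  refine Finset.measurable_sum _ fun n _ => Measurable.ite
    (measurableSet_le (Measurable.fract (by fun_prop)) measurable_const)
    measurable_const measurable_const

theorem W_nonneg (α L : ℝ) (N : ℕ) (y : ℝ) : 0 ≤ W α L N y := Nat.cast_nonneg _

theorem W_le (α L : ℝ) (N : ℕ) (y : ℝ) : W α L N y ≤ N := by
  unfold W
  exact_mod_cast (Finset.card_filter_le _ _).trans (by simp)

theorem W_mono (α : ℝ) {L L' : ℝ} {N N' : ℕ} (hN : N ≤ N') (hL : L / N ≤ L' / N') (y : ℝ) :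
    W α L N y ≤ W α L' N' y := by
  unfold W
  norm_cast
  apply Finset.card_le_card
  intro n
  simp only [Finset.mem_filter, Finset.mem_Icc]
  exact fun h => ⟨⟨h.1.1, h.1.2.trans hN⟩, h.2.trans hL⟩

theorem W_periodic (α L : ℝ) (N : ℕ) : Function.Periodic (W α L N) 1 := by
  intro y
  unfold W
  simp [sub_add_eq_sub_sub]

theorem measurable_W_right (α L : ℝ) (N : ℕ) : Measurable (W α L N) := by
  simpa only [Function.comp_def] using
    (measurable_W L N).comp (measurable_prodMk_left (x := α))

theorem intervalIntegral_sum_sum {ι : Type*} (S : Finset ι) {f : ι → ι → ℝ → ℝ} {a b : ℝ}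
    (hf : ∀ n m, IntervalIntegrable (f n m) volume a b) :
    ∫ x in a..b, ∑ n ∈ S, ∑ m ∈ S, f n m x = ∑ n ∈ S, ∑ m ∈ S, ∫ x in a..b, f n m x := by
  have hrow : ∀ n ∈ S, IntervalIntegrable (fun x => ∑ m ∈ S, f n m x) volume a b := by
    intro n _
    simpa only [Finset.sum_fn] using IntervalIntegrable.sum S fun m _ => hf n m
  rw [intervalIntegral.integral_finsetSum hrow]
  exact Finset.sum_congr rfl fun n _ =>
    intervalIntegral.integral_finsetSum fun m _ => hf n m

/-- The mean square over `(α, y)` of the discrepancy `W - L` is at most `L`. -/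
theorem integral_variance_le {L : ℝ} {N : ℕ} (hN : 0 < N) (hL : 0 ≤ L) (hLN : L ≤ N) :
    ∫ α in (0:ℝ)..1, ∫ y in (0:ℝ)..1, (W α L N y - L) ^ 2 ≤ L := by
  have hN' : (0 : ℝ) < N := by positivity
  obtain ⟨s, hs_def⟩ : ∃ s, s = L / N := ⟨_, rfl⟩
  have hs : 0 ≤ s := by rw [hs_def]; positivity
  have hs1 : s ≤ 1 := by rwa [hs_def, div_le_one hN']
  have hm := measurable_centredArc s
  obtain ⟨h, hh⟩ : ∃ h : ℕ → ℕ → ℝ → ℝ → ℝ, ∀ n m α y, h n m α y =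
      centredArc s (α * (n : ℝ) ^ 2 - y) * centredArc s (α * (m : ℝ) ^ 2 - y) :=
    ⟨_, fun _ _ _ _ => rfl⟩
  have hmeas : ∀ n m, Measurable (fun p : ℝ × ℝ => h n m p.1 p.2) := by
    intro n m
    simp only [hh]
    fun_prop
  have hbound : ∀ n m α y, |h n m α y| ≤ 1 := by
    intro n m α y
    rw [hh, abs_mul]
    exact mul_le_one₀ (abs_centredArc_le hs hs1 _) (abs_nonneg _) (abs_centredArc_le hs hs1 _)
  have hint : ∀ n m α, IntervalIntegrable (h n m α) volume 0 1 := fun n m α =>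
    intervalIntegrable_of_abs_le ((hmeas n m).comp measurable_prodMk_left) (hbound n m α) 0 1
  have hint' : ∀ n m, IntervalIntegrable (fun α => ∫ y in (0:ℝ)..1, h n m α y) volume 0 1 := by
    intro n m
    refine intervalIntegrable_of_abs_le (C := 1) ?_ ?_ 0 1
    · simp_rw [intervalIntegral.integral_of_le zero_le_one]
      exact ((hmeas n m).stronglyMeasurable.integral_prod_right
        (ν := volume.restrict (Set.Ioc (0:ℝ) 1))).measurable
    · intro α
      have := intervalIntegral.norm_integral_le_of_norm_le_const (a := 0) (b := 1)
        (f := h n m α) (C := 1) fun y _ => hbound n m α y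
      simpa using this
  have hexp : ∀ α, ∫ y in (0:ℝ)..1, (W α L N y - L) ^ 2 =
      ∑ n ∈ Finset.Icc 1 N, ∑ m ∈ Finset.Icc 1 N, ∫ y in (0:ℝ)..1, h n m α y := by
    intro α
    simp_rw [W_sub_eq_sum α L hN, ← hs_def, sq (∑ n ∈ _, _), Finset.sum_mul_sum, ← hh]
    exact intervalIntegral_sum_sum _ fun n m => hint n m α
  simp_rw [hexp]
  rw [intervalIntegral_sum_sum _ hint']
  have hrow : ∀ n ∈ Finset.Icc 1 N, ∑ m ∈ Finset.Icc 1 N,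
      ∫ α in (0:ℝ)..1, ∫ y in (0:ℝ)..1, h n m α y ≤ s := by
    intro n hn
    rw [Finset.sum_eq_single_of_mem n hn]
    · have hsq : Function.Periodic (fun x => centredArc s x ^ 2) 1 := fun x => by
        simp only [centredArc_periodic s x]
      have : ∀ α, ∫ y in (0:ℝ)..1, h n n α y = ∫ y in (0:ℝ)..1, centredArc s y ^ 2 := by
        intro α
        rw [← hsq.integral_comp_const_sub (α * (n : ℝ) ^ 2)]
        simp only [hh, sq]
      simp_rw [this]
      simpa using integral_centredArc_sq_le hs hs1
    · intro m _ hmn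
      have hne : ((n : ℤ) ^ 2) ≠ (m : ℤ) ^ 2 := by
        intro heq
        have : n ^ 2 = m ^ 2 := by exact_mod_cast heq
        exact hmn (Nat.pow_left_injective (by norm_num) this).symm
      have := integral_centredArc_mul_eq_zero hs hs1 hne
      simpa [hh] using this
  calc _ ≤ ∑ n ∈ Finset.Icc 1 N, s := Finset.sum_le_sum hrow
    _ = L := by simp [hs_def]; field_simp

/-- The variance in `y` of the counting function, for fixed `α`. -/
noncomputable def countVariance (α L : ℝ) (N : ℕ) : ℝ :=
  ∫ y in (0:ℝ)..1, (W α L N y - L) ^ 2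

theorem countVariance_nonneg (α L : ℝ) (N : ℕ) : 0 ≤ countVariance α L N :=
  intervalIntegral.integral_nonneg zero_le_one fun _ _ => sq_nonneg _

theorem measurable_countVariance (L : ℝ) (N : ℕ) :
    Measurable (fun α => countVariance α L N) := by
  have h : Measurable (fun p : ℝ × ℝ => (W p.1 L N p.2 - L) ^ 2) :=
    ((measurable_W L N).sub_const L).pow_const 2
  simp only [countVariance, intervalIntegral.integral_of_le (zero_le_one (α := ℝ))]
  exact (h.stronglyMeasurable.integral_prod_right
    (ν := volume.restrict (Set.Ioc (0:ℝ) 1))).measurable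

theorem abs_W_sub_le (α L : ℝ) (N : ℕ) (y : ℝ) : |W α L N y - L| ≤ N + |L| :=
  (abs_sub _ _).trans (by
    rw [abs_of_nonneg (W_nonneg α L N y)]
    linarith [W_le α L N y])

theorem intervalIntegrable_W_pow (α L : ℝ) (N k : ℕ) (a b : ℝ) :
    IntervalIntegrable (fun y => W α L N y ^ k) volume a b :=
  intervalIntegrable_of_abs_le (C := (N : ℝ) ^ k) ((measurable_W_right α L N).pow_const k)
    (fun y => by
      rw [abs_of_nonneg (pow_nonneg (W_nonneg α L N y) k)]
      exact pow_le_pow_left₀ (W_nonneg α L N y) (W_le α L N y) k) a b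

theorem intervalIntegrable_W (α L : ℝ) (N : ℕ) (a b : ℝ) :
    IntervalIntegrable (W α L N) volume a b := by
  simpa using intervalIntegrable_W_pow α L N 1 a b

theorem intervalIntegrable_W_sub_sq (α L : ℝ) (N : ℕ) (a b : ℝ) :
    IntervalIntegrable (fun y => (W α L N y - L) ^ 2) volume a b :=
  intervalIntegrable_of_abs_le (C := (N + |L|) ^ 2)
    (((measurable_W_right α L N).sub_const L).pow_const 2)
    (fun y => by
      rw [abs_pow]
      exact pow_le_pow_left₀ (abs_nonneg _) (abs_W_sub_le α L N y) 2) a b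

theorem countVariance_le (α L : ℝ) (N : ℕ) : countVariance α L N ≤ (N + |L|) ^ 2 := by
  have := intervalIntegral.norm_integral_le_of_norm_le_const (a := 0) (b := 1)
    (f := fun y => (W α L N y - L) ^ 2) (C := (N + |L|) ^ 2) fun y _ => by
      rw [Real.norm_eq_abs, abs_pow]
      exact pow_le_pow_left₀ (abs_nonneg _) (abs_W_sub_le α L N y) 2
  simp only [sub_zero, abs_one, mul_one] at this
  exact (le_abs_self _).trans this

/-- Almost surely, the variances along a countable family of parameters are bounded by their
means, up to a summable weight. -/
theorem ae_exists_countVariance_le {ι : Type*} [Countable ι] {L b : ι → ℝ} {N : ι → ℕ}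
    (hN : ∀ i, 0 < N i) (hL : ∀ i, 0 < L i) (hLN : ∀ i, L i ≤ N i) (hb : ∀ i, 0 < b i)
    (hsum : Summable b) :
    ∀ᵐ α ∂(volume.restrict (Set.Icc (0:ℝ) 1)), ∃ C : ℝ, 0 ≤ C ∧
      ∀ i, b i * countVariance α (L i) (N i) ≤ C * L i := by
  have hmeas : ∀ i, Measurable (fun α =>
      ENNReal.ofReal (b i / L i * countVariance α (L i) (N i))) := fun i =>
    ((measurable_countVariance (L i) (N i)).const_mul _).ennreal_ofReal
  have hle : ∀ i, ∫⁻ α in Set.Icc (0:ℝ) 1,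
      ENNReal.ofReal (b i / L i * countVariance α (L i) (N i)) ≤ ENNReal.ofReal (b i) := by
    intro i
    have hpos : 0 ≤ b i / L i := (div_pos (hb i) (hL i)).le
    have hint : IntervalIntegrable (fun α => b i / L i * countVariance α (L i) (N i))
        volume 0 1 :=
      (intervalIntegrable_of_abs_le (measurable_countVariance (L i) (N i))
        (fun α => by
          rw [abs_of_nonneg (countVariance_nonneg α _ _)]
          exact countVariance_le α _ _) 0 1).const_mul _
    rw [← restrict_Ioc_eq_restrict_Icc,
      ← ofReal_integral_eq_lintegral_ofReal hint.1
        (Filter.Eventually.of_forall fun α => mul_nonneg hpos (countVariance_nonneg α _ _)),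
      ← intervalIntegral.integral_of_le zero_le_one, intervalIntegral.integral_const_mul]
    apply ENNReal.ofReal_le_ofReal
    calc b i / L i * ∫ α in (0:ℝ)..1, countVariance α (L i) (N i)
        ≤ b i / L i * L i :=
          mul_le_mul_of_nonneg_left (integral_variance_le (hN i) (hL i).le (hLN i)) hpos
      _ = b i := div_mul_cancel₀ _ (hL i).ne'
  have hfin : ∫⁻ α in Set.Icc (0:ℝ) 1,
      ∑' i, ENNReal.ofReal (b i / L i * countVariance α (L i) (N i)) ≠ ⊤ := by
    rw [lintegral_tsum fun i => (hmeas i).aemeasurable]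
    exact ne_top_of_le_ne_top hsum.tsum_ofReal_ne_top (ENNReal.tsum_le_tsum hle)
  filter_upwards [ae_lt_top (Measurable.tsum hmeas) hfin] with α hα
  refine ⟨(∑' i, ENNReal.ofReal (b i / L i * countVariance α (L i) (N i))).toReal,
    ENNReal.toReal_nonneg, fun i => ?_⟩
  have hi := (ENNReal.ofReal_le_iff_le_toReal hα.ne).1
    (ENNReal.le_tsum (f := fun i => ENNReal.ofReal (b i / L i * countVariance α (L i) (N i))) i)
  rw [div_mul_eq_mul_div, div_le_iff₀ (hL i)] at hi
  exact hi

/-- An arc of length `s` starting at `y` is covered by the two arcs of length `s` that end and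
start at a point `y'` of it. -/
theorem W_le_add (α L : ℝ) (N : ℕ) {y y' : ℝ} (h : y ≤ y') (h' : y' ≤ y + L / N) :
    W α L N y ≤ W α L N y' + W α L N (y' - L / N) := by
  unfold W
  rw [← Nat.cast_add, Nat.cast_le]
  refine (Finset.card_le_card ?_).trans (Finset.card_union_le _ _)
  intro n
  simp only [Finset.mem_union, Finset.mem_filter]
  rintro ⟨hn, hle⟩
  set x := α * (n : ℝ) ^ 2
  have hx0 := Int.fract_nonneg (x - y)
  rcases le_total (y' - y) (Int.fract (x - y)) with hc | hc
  · left
    refine ⟨hn, le_trans (le_of_eq ?_) ((sub_le_self _ (sub_nonneg.2 h)).trans hle)⟩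
    rw [Int.fract_eq_iff]
    refine ⟨by linarith, by linarith [Int.fract_lt_one (x - y)], ⌊x - y⌋, ?_⟩
    rw [← Int.self_sub_floor]
    ring
  · right
    refine ⟨hn, ?_⟩
    have h1 : x - (y' - L / N) = (x - y) + (L / N - (y' - y)) := by ring
    have h2 := Int.fract_add_le (x - y) (L / N - (y' - y))
    have h3 : Int.fract (L / N - (y' - y)) ≤ L / N - (y' - y) := by
      have : (0 : ℤ) ≤ ⌊L / N - (y' - y)⌋ := Int.floor_nonneg.2 (by linarith)
      have : (0 : ℝ) ≤ ⌊L / N - (y' - y)⌋ := by exact_mod_cast this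
      rw [← Int.self_sub_floor]
      linarith
    rw [h1]
    linarith

/-- The maximum of the counting function is controlled by its variance. -/
theorem W_le_of_countVariance (α : ℝ) {L : ℝ} {N : ℕ} (hN : 0 < N) (hL : 0 < L) (hLN : L ≤ N)
    (y : ℝ) : W α L N y ≤ 2 * L + 2 * √(countVariance α L N * (N / L)) := by
  have hN' : (0 : ℝ) < N := by positivity
  set s := L / N with hs_def
  have hs : 0 < s := by positivity
  have hs1 : s ≤ 1 := (div_le_one hN').2 hLN
  rcases le_total (W α L N y) (2 * L) with hw | hw
  · linarith [Real.sqrt_nonneg (countVariance α L N * (N / L))]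
  set F : ℝ → ℝ := fun t => (W α L N t - L) ^ 2 with hF
  have hint : ∀ a b, IntervalIntegrable F volume a b := intervalIntegrable_W_sub_sq α L N
  have hper : Function.Periodic F 1 := fun t => by simp only [hF, W_periodic α L N t]
  have hpt : ∀ t ∈ Set.Icc y (y + s),
      (W α L N y - 2 * L) ^ 2 ≤ 2 * F t + 2 * F (t - s) := by
    intro t ht
    have h1 := W_le_add α L N ht.1 ht.2
    rw [← hs_def] at h1
    have h2 : (W α L N y - 2 * L) ^ 2 ≤ ((W α L N t - L) + (W α L N (t - s) - L)) ^ 2 :=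
      pow_le_pow_left₀ (by linarith) (by linarith) 2
    simp only [hF]
    nlinarith [sq_nonneg ((W α L N t - L) - (W α L N (t - s) - L))]
  have hunit : ∀ a, ∫ t in a..a + s, F t ≤ countVariance α L N := by
    intro a
    calc ∫ t in a..a + s, F t ≤ ∫ t in a..a + 1, F t :=
          intervalIntegral.integral_mono_interval le_rfl (by linarith) (by linarith)
            (Filter.Eventually.of_forall fun t => sq_nonneg _) (hint _ _)
      _ = countVariance α L N := by
          rw [hper.intervalIntegral_add_eq a 0, zero_add, countVariance]
  have hshift : IntervalIntegrable (fun t => F (t - s)) volume y (y + s) := by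
    simpa using (hint (y - s) (y + s - s)).comp_sub_right s
  have hmono := intervalIntegral.integral_mono_on (by linarith : y ≤ y + s)
    intervalIntegrable_const
    (((hint _ _).const_mul 2).add (hshift.const_mul 2)) hpt
  rw [intervalIntegral.integral_const, intervalIntegral.integral_add ((hint _ _).const_mul 2)
    (hshift.const_mul 2), intervalIntegral.integral_const_mul,
    intervalIntegral.integral_const_mul, intervalIntegral.integral_comp_sub_right] at hmono
  have h1 := hunit y
  have h2 := hunit (y - s)
  rw [show y - s + s = y + s - s by ring] at h2
  have h3 : (W α L N y - 2 * L) ^ 2 ≤ 2 ^ 2 * (countVariance α L N * (N / L)) := by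
    have h4 : s * (W α L N y - 2 * L) ^ 2 ≤ 4 * countVariance α L N := by
      simp only [add_sub_cancel_left, smul_eq_mul] at hmono
      linarith
    have h5 : (N : ℝ) / L = 1 / s := by rw [hs_def, one_div_div]
    rw [h5, mul_one_div, mul_div_assoc', le_div_iff₀ hs]
    linarith
  have h6 := Real.le_sqrt_of_sq_le h3
  rw [Real.sqrt_mul (by norm_num), Real.sqrt_sq (by norm_num)] at h6
  linarith

theorem integral_W (α : ℝ) {L : ℝ} {N : ℕ} (hN : 0 < N) (hL : 0 ≤ L) (hLN : L ≤ N) :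
    ∫ y in (0:ℝ)..1, (W α L N y - L) = 0 := by
  have hN' : (0 : ℝ) < N := by positivity
  have hs : 0 ≤ L / N := by positivity
  have hs1 : L / N ≤ 1 := (div_le_one hN').2 hLN
  simp_rw [W_sub_eq_sum α L hN]
  rw [intervalIntegral.integral_finsetSum]
  · refine Finset.sum_eq_zero fun n _ => ?_
    rw [(centredArc_periodic _).integral_comp_const_sub, integral_centredArc hs hs1]
  · intro n _
    exact intervalIntegrable_of_abs_le ((measurable_centredArc _).comp (by fun_prop))
      (fun y => abs_centredArc_le hs hs1 _) 0 1

theorem abs_third_moment_sub_le (α : ℝ) {L : ℝ} {N : ℕ} (hN : 0 < N) (hL : 0 < L)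
    (hLN : L ≤ N) :
    |(∫ y in (0:ℝ)..1, W α L N y ^ 3) - L ^ 3| ≤
      (4 * L + 2 * √(countVariance α L N * (N / L))) * countVariance α L N := by
  set S := 2 * √(countVariance α L N * (N / L)) with hS
  have hW := W_le_of_countVariance α hN hL hLN
  have hint := intervalIntegrable_W_sub_sq α L N 0 1
  have hpt : ∀ y, W α L N y ^ 3 - 3 * L ^ 2 * (W α L N y - L) - L ^ 3 =
      (W α L N y - L) ^ 2 * (W α L N y + 2 * L) := fun y => by ring
  have hint1 : IntervalIntegrable (fun y => 3 * L ^ 2 * (W α L N y - L)) volume 0 1 :=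
    ((intervalIntegrable_W α L N 0 1).sub intervalIntegrable_const).const_mul _
  have hint2 := (intervalIntegrable_W_pow α L N 3 0 1).sub hint1
  have heq : (∫ y in (0:ℝ)..1, W α L N y ^ 3) - L ^ 3 =
      ∫ y in (0:ℝ)..1, (W α L N y - L) ^ 2 * (W α L N y + 2 * L) := by
    simp_rw [← hpt]
    rw [intervalIntegral.integral_sub hint2 intervalIntegrable_const,
      intervalIntegral.integral_sub (intervalIntegrable_W_pow α L N 3 0 1) hint1,
      intervalIntegral.integral_const_mul, integral_W α hN hL.le hLN]
    simp
  have hint3 : IntervalIntegrable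
      (fun y => (W α L N y - L) ^ 2 * (W α L N y + 2 * L)) volume 0 1 := by
    simp_rw [← hpt]
    exact hint2.sub intervalIntegrable_const
  rw [heq, abs_of_nonneg (intervalIntegral.integral_nonneg zero_le_one fun y _ =>
    mul_nonneg (sq_nonneg _) (by linarith [W_nonneg α L N y]))]
  calc _ ≤ ∫ y in (0:ℝ)..1, (4 * L + S) * (W α L N y - L) ^ 2 := by
        refine intervalIntegral.integral_mono_on zero_le_one hint3 (hint.const_mul _) ?_
        intro y _
        rw [mul_comm]
        exact mul_le_mul_of_nonneg_right (by linarith [hW y]) (sq_nonneg _)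
    _ = _ := by rw [intervalIntegral.integral_const_mul, countVariance]

theorem third_moment_mono (α : ℝ) {L L' : ℝ} {N N' : ℕ} (hN : N ≤ N')
    (hL : L / N ≤ L' / N') :
    ∫ y in (0:ℝ)..1, W α L N y ^ 3 ≤ ∫ y in (0:ℝ)..1, W α L' N' y ^ 3 :=
  intervalIntegral.integral_mono_on zero_le_one (intervalIntegrable_W_pow α L N 3 0 1)
    (intervalIntegrable_W_pow α L' N' 3 0 1) fun y _ =>
      pow_le_pow_left₀ (W_nonneg α L N y) (W_mono α hN hL y) 3

/-- If all variances on the grid `L = i ^ (4k)`, `N = j ^ (4k)` are nearly as small as expected,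
then the third moment on the grid is asymptotic to `L ^ 3`, as soon as `L` exceeds a slightly
larger power of `N` than the fourth root. -/
theorem exists_third_moment_grid_bound {α D : ℝ} {k : ℕ} (hk : 1 ≤ k) (hD : 0 ≤ D)
    (hV : ∀ i j : ℕ, 1 ≤ i → i ≤ j →
      countVariance α ((i : ℝ) ^ (4 * k)) (j ^ (4 * k)) ≤ D ^ 2 * j ^ 4 * i ^ (4 * k))
    (B : ℝ) {δ : ℝ} (hδ : 0 < δ) :
    ∃ J : ℕ, ∀ i j : ℕ, 1 ≤ i → i ≤ j → J ≤ j → (j : ℝ) ^ (k + 4) ≤ B * i ^ (4 * k) →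
      |(∫ y in (0:ℝ)..1, W α ((i : ℝ) ^ (4 * k)) (j ^ (4 * k)) y ^ 3) - ((i : ℝ) ^ (4 * k)) ^ 3| ≤
        δ * ((i : ℝ) ^ (4 * k)) ^ 3 := by
  obtain ⟨J, hJ⟩ := exists_nat_ge ((4 * D ^ 2 * B + 2 * D ^ 3 * B ^ 2) / δ)
  refine ⟨J, fun i j hi hij hjJ hcond => ?_⟩
  have hj : 1 ≤ j := hi.trans hij
  have hiR : (1 : ℝ) ≤ i := by exact_mod_cast hi
  have hjR : (1 : ℝ) ≤ j := by exact_mod_cast hj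
  have hijR : (i : ℝ) ≤ j := by exact_mod_cast hij
  have hN : 0 < j ^ (4 * k) := by positivity
  have hV' := hV i j hi hij
  set X : ℝ := (i : ℝ) ^ (4 * k) with hX
  have hX0 : 0 < X := by positivity
  have hXN : X ≤ ((j ^ (4 * k) : ℕ) : ℝ) := by
    push_cast
    exact pow_le_pow_left₀ (by linarith) hijR _
  refine (abs_third_moment_sub_le α hN hX0 hXN).trans ?_
  set V := countVariance α X (j ^ (4 * k))
  have hV0 : 0 ≤ V := countVariance_nonneg _ _ _
  have hsqrt : √(V * (((j ^ (4 * k) : ℕ) : ℝ) / X)) ≤ D * j ^ (2 * k + 2) := by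
    apply Real.sqrt_le_iff.2 ⟨by positivity, ?_⟩
    calc V * (((j ^ (4 * k) : ℕ) : ℝ) / X)
        ≤ (D ^ 2 * j ^ 4 * X) * (((j ^ (4 * k) : ℕ) : ℝ) / X) := by gcongr
      _ = (D * j ^ (2 * k + 2)) ^ 2 := by
        push_cast
        field_simp
        ring
  have hY : (j : ℝ) ^ 4 * j ≤ B * X := by
    refine le_trans ?_ hcond
    rw [← pow_succ]
    exact pow_le_pow_right₀ hjR (by omega)
  have hZ : (j : ℝ) ^ (2 * k + 6) * j ≤ B ^ 2 * X ^ 2 := by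
    calc (j : ℝ) ^ (2 * k + 6) * j = (j : ℝ) ^ (2 * k + 7) := by ring
      _ ≤ (j : ℝ) ^ (2 * k + 8) := pow_le_pow_right₀ hjR (by omega)
      _ = ((j : ℝ) ^ (k + 4)) ^ 2 := by ring
      _ ≤ (B * X) ^ 2 := pow_le_pow_left₀ (by positivity) hcond 2
      _ = B ^ 2 * X ^ 2 := by ring
  have hJj : 4 * D ^ 2 * B + 2 * D ^ 3 * B ^ 2 ≤ δ * j := by
    rw [div_le_iff₀ hδ] at hJ
    have : (J : ℝ) ≤ j := by exact_mod_cast hjJ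
    nlinarith
  calc (4 * X + 2 * √(V * (((j ^ (4 * k) : ℕ) : ℝ) / X))) * V
      ≤ (4 * X + 2 * (D * j ^ (2 * k + 2))) * (D ^ 2 * j ^ 4 * X) := by gcongr
    _ = (4 * D ^ 2 * X * (j ^ 4 * j) + 2 * D ^ 3 * (j ^ (2 * k + 6) * j)) * X / j := by
        field_simp
        ring
    _ ≤ (4 * D ^ 2 * X * (B * X) + 2 * D ^ 3 * (B ^ 2 * X ^ 2)) * X / j := by gcongr
    _ = (4 * D ^ 2 * B + 2 * D ^ 3 * B ^ 2) * X ^ 3 / j := by ring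
    _ ≤ (δ * j) * X ^ 3 / j := by gcongr
    _ = δ * X ^ 3 := by field_simp

theorem exists_pow_le_lt_pow {K : ℕ} (hK : K ≠ 0) {x : ℝ} (hx : 0 ≤ x) :
    ∃ m : ℕ, (m : ℝ) ^ K ≤ x ∧ x < ((m + 1 : ℕ) : ℝ) ^ K := by
  have hex : ∃ m : ℕ, x < ((m + 1 : ℕ) : ℝ) ^ K := by
    obtain ⟨m, hm⟩ := exists_nat_gt x
    refine ⟨m, hm.trans_le ?_⟩
    exact_mod_cast (Nat.le_succ m).trans (Nat.le_self_pow hK (m + 1))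
  classical
  refine ⟨Nat.find hex, ?_, Nat.find_spec hex⟩
  rcases h : Nat.find hex with _ | m
  · simpa [hK] using hx
  · exact not_lt.1 (Nat.find_min hex (h ▸ Nat.lt_succ_self m))

theorem exists_pow_lt_le_pow {K : ℕ} (hK : K ≠ 0) {x : ℝ} (hx : 0 < x) :
    ∃ m : ℕ, (m : ℝ) ^ K < x ∧ x ≤ ((m + 1 : ℕ) : ℝ) ^ K := by
  have hex : ∃ m : ℕ, x ≤ ((m + 1 : ℕ) : ℝ) ^ K := by
    obtain ⟨m, hm⟩ := exists_nat_ge x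
    refine ⟨m, hm.trans ?_⟩
    exact_mod_cast (Nat.le_succ m).trans (Nat.le_self_pow hK (m + 1))
  classical
  refine ⟨Nat.find hex, ?_, Nat.find_spec hex⟩
  rcases h : Nat.find hex with _ | m
  · simpa [hK] using hx
  · exact not_le.1 (Nat.find_min hex (h ▸ Nat.lt_succ_self m))

theorem exists_succ_pow_le (K : ℕ) {d : ℝ} (hd : 0 < d) :
    ∃ T : ℕ, ∀ m : ℕ, T ≤ m → ((m + 1 : ℕ) : ℝ) ^ K ≤ (1 + d) * (m : ℝ) ^ K := by
  have h : Filter.Tendsto (fun m : ℕ => (1 + 1 / (m : ℝ)) ^ K) Filter.atTop (nhds 1) := by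
    simpa using ((tendsto_one_div_atTop_nhds_zero_nat (𝕜 := ℝ)).const_add 1).pow K
  obtain ⟨T, hT⟩ := Filter.eventually_atTop.1
    (h.eventually_le_const (show (1 : ℝ) < 1 + d by linarith))
  refine ⟨T + 1, fun m hm => ?_⟩
  have hm0 : (0 : ℝ) < m := by exact_mod_cast (by omega : 0 < m)
  have h1 : ((m + 1 : ℕ) : ℝ) = (1 + 1 / (m : ℝ)) * m := by
    push_cast
    field_simp
  rw [h1, mul_pow]
  exact mul_le_mul_of_nonneg_right (hT m (by omega)) (by positivity)

theorem exists_small_perturbation {δ : ℝ} (hδ : 0 < δ) :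
    ∃ d : ℝ, 0 < d ∧ d ≤ 1 ∧ (1 + d) ^ 7 ≤ 1 + δ ∧ (1 - δ) * (1 + d) ^ 6 ≤ 1 - d := by
  have h1 : ∀ᶠ d : ℝ in nhds 0, (1 + d) ^ 7 < 1 + δ :=
    ContinuousAt.eventually_lt (by fun_prop) (by fun_prop) (by simpa)
  have h2 : ∀ᶠ d : ℝ in nhds 0, (1 - δ) * (1 + d) ^ 6 < 1 - d :=
    ContinuousAt.eventually_lt (by fun_prop) (by fun_prop) (by simpa)
  have h3 : ∀ᶠ d : ℝ in nhds 0, d < 1 := eventually_lt_nhds one_pos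
  obtain ⟨d, ⟨⟨h1, h2⟩, h3⟩, h4⟩ :=
    ((((h1.and h2).and h3).filter_mono nhdsWithin_le_nhds).and
      (self_mem_nhdsWithin (a := (0 : ℝ)) (s := Set.Ioi 0))).exists
  exact ⟨d, h4, h3.le, h1.le, h2.le⟩

theorem ae_exists_grid_countVariance_le {K : ℕ} :
    ∀ᵐ α ∂(volume.restrict (Set.Icc (0:ℝ) 1)), ∃ D : ℝ, 0 ≤ D ∧
      ∀ i j : ℕ, 1 ≤ i → i ≤ j →
        countVariance α ((i : ℝ) ^ K) (j ^ K) ≤ D ^ 2 * j ^ 4 * i ^ K := by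
  have hsum : Summable fun p : {p : ℕ × ℕ // 1 ≤ p.1 ∧ p.1 ≤ p.2} =>
      1 / (p.1.1 : ℝ) ^ 2 * (1 / (p.1.2 : ℝ) ^ 2) := by
    have h := Real.summable_one_div_nat_pow.2 one_lt_two
    exact (h.mul_of_nonneg h (fun _ => by positivity) fun _ => by positivity).subtype _
  have hae := ae_exists_countVariance_le
    (ι := {p : ℕ × ℕ // 1 ≤ p.1 ∧ p.1 ≤ p.2}) (L := fun p => (p.1.1 : ℝ) ^ K)
    (N := fun p => p.1.2 ^ K) (fun p => pow_pos (p.2.1.trans p.2.2) K)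
    (fun p => pow_pos (Nat.cast_pos.2 p.2.1) K)
    (fun p => by
      push_cast
      exact pow_le_pow_left₀ (Nat.cast_nonneg _) (Nat.cast_le.2 p.2.2) K)
    (fun p => mul_pos (one_div_pos.2 (pow_pos (Nat.cast_pos.2 p.2.1) 2))
      (one_div_pos.2 (pow_pos (Nat.cast_pos.2 (p.2.1.trans p.2.2)) 2))) hsum
  filter_upwards [hae] with α hα
  obtain ⟨C, hC, hV⟩ := hα
  refine ⟨√C, Real.sqrt_nonneg C, fun i j hi hij => ?_⟩
  have h := hV ⟨(i, j), hi, hij⟩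
  have hi0 : (0 : ℝ) < i := Nat.cast_pos.2 hi
  have hj0 : (0 : ℝ) < j := Nat.cast_pos.2 (hi.trans hij)
  have hijR : (i : ℝ) ≤ j := Nat.cast_le.2 hij
  rw [Real.sq_sqrt hC]
  dsimp only at h
  calc countVariance α ((i : ℝ) ^ K) (j ^ K)
      = i ^ 2 * j ^ 2 *
        (1 / (i : ℝ) ^ 2 * (1 / (j : ℝ) ^ 2) * countVariance α ((i : ℝ) ^ K) (j ^ K)) := by
        field_simp
    _ ≤ j ^ 2 * j ^ 2 * (C * i ^ K) := by
        refine mul_le_mul (by gcongr) h ?_ (by positivity)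
        exact mul_nonneg (by positivity) (countVariance_nonneg _ _ _)
    _ = C * j ^ 4 * i ^ K := by ring

/-- Lower bound for the third moment by comparison with the grid point below `(L, N)`. -/
theorem le_third_moment_of_grid
    {α L d : ℝ} {k j N T J : ℕ} (hk : 1 ≤ k) (hd0 : 0 < d) (hd1 : d ≤ 1)
    (hJ : ∀ i j : ℕ, 1 ≤ i → i ≤ j → J ≤ j →
      (j : ℝ) ^ (k + 4) ≤ 4 ^ (4 * k) * (i : ℝ) ^ (4 * k) →
      |(∫ y in (0:ℝ)..1, W α ((i : ℝ) ^ (4 * k)) (j ^ (4 * k)) y ^ 3) - ((i : ℝ) ^ (4 * k)) ^ 3| ≤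
        d * ((i : ℝ) ^ (4 * k)) ^ 3)
    (hT : ∀ m : ℕ, T ≤ m → ((m + 1 : ℕ) : ℝ) ^ (4 * k) ≤ (1 + d) * (m : ℝ) ^ (4 * k))
    (hj : 1 ≤ j) (hJj : J ≤ j) (hTj : T ≤ j)
    (hjN : (j : ℝ) ^ (4 * k) ≤ N) (hNj : (N : ℝ) < ((j + 1 : ℕ) : ℝ) ^ (4 * k))
    (hjL : (j : ℝ) ^ (k + 4) < L)
    (hTL : (4 : ℝ) ^ (4 * k) * ((T + 2 : ℕ) : ℝ) ^ (4 * k) < L) (hLN : L ≤ N) :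
    (1 - d) * L ^ 3 ≤ (1 + d) ^ 6 * ∫ y in (0:ℝ)..1, W α L N y ^ 3 := by
  have hK : 4 * k ≠ 0 := by omega
  have hj1 : (1 : ℝ) ≤ j := by exact_mod_cast hj
  have hN0 : (0 : ℝ) < N := lt_of_lt_of_le (by positivity) hjN
  have hL0 : 0 < L := lt_of_le_of_lt (by positivity) hjL
  have hratio : ((j + 1 : ℕ) : ℝ) ^ (4 * k) ≤ (1 + d) * N :=
    (hT j hTj).trans (by gcongr)
  have h4 : (4 : ℝ) ≤ 4 ^ (4 * k) := le_self_pow₀ (by norm_num) hK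
  have h2pow : (2 : ℝ) * 2 ^ (4 * k) ≤ 4 ^ (4 * k) := by
    rw [show (4 : ℝ) = 2 ^ 2 by norm_num, ← pow_mul, ← pow_succ']
    exact pow_le_pow_right₀ (by norm_num) (by omega)
  have hjN' : j ^ (4 * k) ≤ N := by exact_mod_cast hjN
  set L' := L * (j : ℝ) ^ (4 * k) / N with hL'
  have hL'0 : 0 < L' := by positivity
  have hLL' : L ≤ (1 + d) * L' := by
    rw [hL', mul_div_assoc', le_div_iff₀ hN0]
    nlinarith [hNj, hT j hTj]
  have hL'j : L' ≤ (j : ℝ) ^ (4 * k) := by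
    rw [hL', div_le_iff₀ hN0, mul_comm]
    gcongr
  obtain ⟨i, hiL', hL'i⟩ := exists_pow_le_lt_pow hK hL'0.le
  have hTi : T < i := by
    have h1 : ((T + 2 : ℕ) : ℝ) ^ (4 * k) < ((i + 1 : ℕ) : ℝ) ^ (4 * k) := by
      have : (0 : ℝ) ≤ ((T + 2 : ℕ) : ℝ) ^ (4 * k) := by positivity
      nlinarith
    have := lt_of_pow_lt_pow_left₀ _ (by positivity) h1
    have : T + 2 < i + 1 := by exact_mod_cast this
    omega
  have hij : i ≤ j := by
    have : (i : ℝ) ≤ j := le_of_pow_le_pow_left₀ hK (by positivity) (hiL'.trans hL'j)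
    exact_mod_cast this
  have hi1 : (1 : ℝ) ≤ i := by exact_mod_cast (by omega : 1 ≤ i)
  have hcond : (j : ℝ) ^ (k + 4) ≤ 4 ^ (4 * k) * (i : ℝ) ^ (4 * k) := by
    have h1 : ((i + 1 : ℕ) : ℝ) ^ (4 * k) ≤ 2 ^ (4 * k) * (i : ℝ) ^ (4 * k) := by
      rw [← mul_pow]
      apply pow_le_pow_left₀ (by positivity)
      push_cast
      linarith
    have h2 : (0 : ℝ) ≤ (i : ℝ) ^ (4 * k) := by positivity
    nlinarith
  have hgrid := (abs_le.1 (hJ i j (by omega) hij hJj hcond)).1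
  have hmono := third_moment_mono α (L := (i : ℝ) ^ (4 * k)) (L' := L) hjN' (by
    push_cast
    rw [div_le_div_iff₀ (by positivity) hN0, ← le_div_iff₀ hN0]
    exact hiL')
  have hLi : L ≤ (1 + d) ^ 2 * (i : ℝ) ^ (4 * k) := by
    have := hT i hTi.le
    nlinarith
  have hL3 : L ^ 3 ≤ (1 + d) ^ 6 * ((i : ℝ) ^ (4 * k)) ^ 3 := by
    calc L ^ 3 ≤ ((1 + d) ^ 2 * (i : ℝ) ^ (4 * k)) ^ 3 := pow_le_pow_left₀ hL0.le hLi 3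
      _ = _ := by ring
  calc (1 - d) * L ^ 3 ≤ (1 - d) * ((1 + d) ^ 6 * ((i : ℝ) ^ (4 * k)) ^ 3) :=
        mul_le_mul_of_nonneg_left hL3 (by linarith)
    _ = (1 + d) ^ 6 * ((1 - d) * ((i : ℝ) ^ (4 * k)) ^ 3) := by ring
    _ ≤ _ := by
        refine mul_le_mul_of_nonneg_left ?_ (by positivity)
        linarith

/-- Upper bound for the third moment by comparison with the grid point above `(L, N)`. -/
theorem third_moment_le_of_grid
    {α L d : ℝ} {k j N T J : ℕ} (hk : 1 ≤ k) (hd0 : 0 < d)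
    (hJ : ∀ i j : ℕ, 1 ≤ i → i ≤ j → J ≤ j →
      (j : ℝ) ^ (k + 4) ≤ 4 ^ (4 * k) * (i : ℝ) ^ (4 * k) →
      |(∫ y in (0:ℝ)..1, W α ((i : ℝ) ^ (4 * k)) (j ^ (4 * k)) y ^ 3) - ((i : ℝ) ^ (4 * k)) ^ 3| ≤
        d * ((i : ℝ) ^ (4 * k)) ^ 3)
    (hT : ∀ m : ℕ, T ≤ m → ((m + 1 : ℕ) : ℝ) ^ (4 * k) ≤ (1 + d) * (m : ℝ) ^ (4 * k))
    (hj : 1 ≤ j) (hJj : J ≤ j) (hTj : T ≤ j)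
    (hjN : (j : ℝ) ^ (4 * k) ≤ N) (hNj : (N : ℝ) < ((j + 1 : ℕ) : ℝ) ^ (4 * k))
    (hjL : (j : ℝ) ^ (k + 4) < L)
    (hTL : (4 : ℝ) ^ (4 * k) * ((T + 2 : ℕ) : ℝ) ^ (4 * k) < L) (hLN : L ≤ N) :
    ∫ y in (0:ℝ)..1, W α L N y ^ 3 ≤ (1 + d) ^ 7 * L ^ 3 := by
  have hK : 4 * k ≠ 0 := by omega
  have hj1 : (1 : ℝ) ≤ j := by exact_mod_cast hj
  have hN0 : (0 : ℝ) < N := lt_of_lt_of_le (by positivity) hjN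
  have hL0 : 0 < L := lt_of_le_of_lt (by positivity) hjL
  have hratio : ((j + 1 : ℕ) : ℝ) ^ (4 * k) ≤ (1 + d) * N :=
    (hT j hTj).trans (by gcongr)
  have h4 : (4 : ℝ) ≤ 4 ^ (4 * k) := le_self_pow₀ (by norm_num) hK
  have h2pow : (2 : ℝ) ^ (k + 4) ≤ 4 ^ (4 * k) := by
    rw [show (4 : ℝ) = 2 ^ 2 by norm_num, ← pow_mul]
    exact pow_le_pow_right₀ (by norm_num) (by omega)
  have hNj' : N ≤ (j + 1) ^ (4 * k) := by exact_mod_cast hNj.le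
  set L' := L * ((j + 1 : ℕ) : ℝ) ^ (4 * k) / N with hL'
  have hL'0 : 0 < L' := by positivity
  have hLL' : L ≤ L' := by
    rw [hL', le_div_iff₀ hN0]
    gcongr
  have hL'L : L' ≤ (1 + d) * L := by
    rw [hL', div_le_iff₀ hN0]
    nlinarith
  have hL'j : L' ≤ ((j + 1 : ℕ) : ℝ) ^ (4 * k) := by
    rw [hL', div_le_iff₀ hN0, mul_comm]
    gcongr
  obtain ⟨m, hmL', hL'm⟩ := exists_pow_lt_le_pow hK hL'0
  have hTm : T < m := by
    have h1 : ((T + 2 : ℕ) : ℝ) ^ (4 * k) < ((m + 1 : ℕ) : ℝ) ^ (4 * k) := by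
      have : (0 : ℝ) ≤ ((T + 2 : ℕ) : ℝ) ^ (4 * k) := by positivity
      nlinarith
    have := lt_of_pow_lt_pow_left₀ _ (by positivity) h1
    have : T + 2 < m + 1 := by exact_mod_cast this
    omega
  have hmj : m + 1 ≤ j + 1 := by
    have : (m : ℝ) < ((j + 1 : ℕ) : ℝ) :=
      lt_of_pow_lt_pow_left₀ _ (by positivity) (hmL'.trans_le hL'j)
    exact_mod_cast this
  have hcond : ((j + 1 : ℕ) : ℝ) ^ (k + 4) ≤ 4 ^ (4 * k) * ((m + 1 : ℕ) : ℝ) ^ (4 * k) := by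
    calc ((j + 1 : ℕ) : ℝ) ^ (k + 4) ≤ (2 * j : ℝ) ^ (k + 4) := by
          apply pow_le_pow_left₀ (by positivity)
          push_cast
          linarith
      _ = 2 ^ (k + 4) * (j : ℝ) ^ (k + 4) := mul_pow _ _ _
      _ ≤ 4 ^ (4 * k) * ((m + 1 : ℕ) : ℝ) ^ (4 * k) := by
          apply mul_le_mul h2pow _ (by positivity) (by positivity)
          linarith
  have hgrid := (abs_le.1 (hJ (m + 1) (j + 1) (by omega) hmj (by omega) hcond)).2
  have hmono := third_moment_mono α (L := L) (L' := ((m + 1 : ℕ) : ℝ) ^ (4 * k)) hNj' (by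
    rw [Nat.cast_pow, div_le_div_iff₀ hN0 (by positivity), ← div_le_iff₀ hN0]
    exact hL'm)
  have hmL : ((m + 1 : ℕ) : ℝ) ^ (4 * k) ≤ (1 + d) ^ 2 * L := by
    have := hT m hTm.le
    nlinarith
  have hL3 : (((m + 1 : ℕ) : ℝ) ^ (4 * k)) ^ 3 ≤ (1 + d) ^ 6 * L ^ 3 := by
    calc _ ≤ ((1 + d) ^ 2 * L) ^ 3 := pow_le_pow_left₀ (by positivity) hmL 3
      _ = _ := by ring
  calc _ ≤ (1 + d) * (((m + 1 : ℕ) : ℝ) ^ (4 * k)) ^ 3 := by linarith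
    _ ≤ (1 + d) * ((1 + d) ^ 6 * L ^ 3) := by gcongr
    _ = _ := by ring

theorem third_moment_quarter_threshold (ε : ℝ) (hε : 0 < ε) :
    ∀ᵐ α ∂(volume.restrict (Set.Icc (0:ℝ) 1)),
      ∀ δ : ℝ, 0 < δ → ∃ N₀ : ℕ, ∀ N : ℕ, N₀ ≤ N → ∀ L : ℝ,
        (N : ℝ) ^ ((1:ℝ)/4 + ε) < L → L ≤ (N : ℝ) →
        |(∫ y in (0:ℝ)..1, (W α L N y)^3) - L^3| ≤ δ * L^3 := by
  obtain ⟨k₀, hk₀⟩ := exists_nat_ge (1 / ε)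
  set k := k₀ + 1 with hk_def
  have hk : 1 ≤ k := by omega
  have hkε : 1 ≤ k * ε := by
    rw [div_le_iff₀ hε] at hk₀
    push_cast [hk_def]
    linarith
  filter_upwards [ae_exists_grid_countVariance_le (K := 4 * k)] with α ⟨D, hD, hV⟩ δ hδ
  obtain ⟨d, hd0, hd1, hup, hlow⟩ := exists_small_perturbation hδ
  obtain ⟨J, hJ⟩ := exists_third_moment_grid_bound hk hD hV
    (4 ^ (4 * k)) hd0
  obtain ⟨T, hT⟩ := exists_succ_pow_le (4 * k) hd0
  have hK : 4 * k ≠ 0 := by omega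
  set j₀ := max J (4 * (T + 2)) ^ (4 * k) with hj₀
  have hj₀J : J ≤ j₀ := (le_max_left _ _).trans (Nat.le_self_pow hK _)
  have hj₀T : (4 * (T + 2)) ^ (4 * k) ≤ j₀ := Nat.pow_le_pow_left (le_max_right _ _) _
  refine ⟨j₀ ^ (4 * k), fun N hN L hNL hLN => ?_⟩
  obtain ⟨j, hjN, hNj⟩ := exists_pow_le_lt_pow hK (Nat.cast_nonneg N : (0 : ℝ) ≤ N)
  have hjj₀ : j₀ ≤ j := by
    have : j₀ ^ (4 * k) < (j + 1) ^ (4 * k) := hN.trans_lt (by exact_mod_cast hNj)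
    exact Nat.lt_succ_iff.1 (lt_of_pow_lt_pow_left₀ _ (Nat.zero_le _) this)
  have hTj₀ : 4 * (T + 2) ≤ j₀ := (Nat.le_self_pow hK _).trans hj₀T
  have hj1 : (1 : ℝ) ≤ j := by exact_mod_cast (by omega : 1 ≤ j)
  have hjL : (j : ℝ) ^ (k + 4) < L := by
    refine lt_of_le_of_lt ?_ hNL
    calc (j : ℝ) ^ (k + 4) = (j : ℝ) ^ ((k + 4 : ℕ) : ℝ) := (Real.rpow_natCast _ _).symm
      _ ≤ (j : ℝ) ^ (((4 * k : ℕ) : ℝ) * (1 / 4 + ε)) := by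
          apply Real.rpow_le_rpow_of_exponent_le hj1
          push_cast
          linarith
      _ = ((j : ℝ) ^ (4 * k)) ^ ((1 : ℝ) / 4 + ε) := by
          rw [Real.rpow_mul (by linarith), Real.rpow_natCast]
      _ ≤ (N : ℝ) ^ ((1 : ℝ) / 4 + ε) := Real.rpow_le_rpow (by positivity) hjN (by positivity)
  have hL0 : 0 < L := lt_of_le_of_lt (by positivity) hjL
  have hTL : (4 : ℝ) ^ (4 * k) * ((T + 2 : ℕ) : ℝ) ^ (4 * k) < L := by
    rw [← mul_pow]
    refine lt_of_le_of_lt ?_ hjL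
    calc ((4 : ℝ) * ((T + 2 : ℕ) : ℝ)) ^ (4 * k) ≤ j := by exact_mod_cast hj₀T.trans hjj₀
      _ ≤ (j : ℝ) ^ (k + 4) := le_self_pow₀ hj1 (by omega)
  have hlower := le_third_moment_of_grid hk hd0 hd1 hJ hT (by omega) (hj₀J.trans hjj₀)
    (by omega) hjN hNj hjL hTL hLN
  have hupper := third_moment_le_of_grid hk hd0 hJ hT (by omega) (hj₀J.trans hjj₀)
    (by omega) hjN hNj hjL hTL hLN
  have hL3 : 0 < L ^ 3 := pow_pos hL0 3
  rw [abs_le]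
  constructor
  · have h : (1 + d) ^ 6 * ((1 - δ) * L ^ 3) ≤
        (1 + d) ^ 6 * ∫ y in (0:ℝ)..1, W α L N y ^ 3 :=
      le_trans (by nlinarith) hlower
    linarith [le_of_mul_le_mul_left h (by positivity)]
  · nlinarith
end

section
/- Let η ∈ (0,1). For Lebesgue-almost all α ∈ [0,1] there exists N₀ = N₀(α,η) such that for every integer N ≥ N₀ there is a prime q with N ≤ q ≤ 2N and ‖qα‖ < N^(−(1−η)). -/
open MeasureTheory

/-- The signed distance from `x` to the nearest integer, normalized to lie in `(−1/2, 1/2]`;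
its absolute value is the distance `‖x‖` from `x` to the nearest integer. -/
noncomputable def sfrac (x : ℝ) : ℝ := 1/2 - Int.fract (1/2 - x)

theorem centralBinom_le_mul_pow_card_primes {n : ℕ} (hn : 2 < n) :
    n.centralBinom ≤ (2 * n) ^ Nat.sqrt (2 * n) * 4 ^ (2 * n / 3) *
      (2 * n) ^ ((Finset.Ioc n (2 * n)).filter Nat.Prime).card := by
  set f : ℕ → ℕ := fun p => p ^ n.centralBinom.factorization p with hf
  have hone : ∀ p, ¬ p.Prime → f p = 1 := fun p hp => by
    simp [hf, Nat.factorization_eq_zero_of_not_prime _ hp]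
  have hpos : ∀ p, p.Prime → 1 ≤ f p := fun p hp => Nat.one_le_pow _ _ hp.pos
  have hle : ∀ p, f p ≤ 2 * n := fun p => Nat.pow_factorization_choose_le (by omega)
  set A := (Finset.Icc 1 (Nat.sqrt (2 * n))).filter Nat.Prime
  set B := ((Finset.range (2 * n / 3 + 1)).filter Nat.Prime).filter
    (fun p => Nat.sqrt (2 * n) < p)
  set C := (Finset.Ioc n (2 * n)).filter Nat.Prime
  have hprod : n.centralBinom = ∏ p ∈ (A ∪ B ∪ C).filter (· ∈ Finset.range (2 * n + 1)), f p := by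
    rw [← n.prod_pow_factorization_centralBinom]
    symm
    apply Finset.prod_subset (fun p hp => (Finset.mem_filter.1 hp).2)
    intro p hp hnot
    by_cases hpp : p.Prime
    · have h0 := hpp.pos
      simp only [A, B, C, Finset.mem_filter, Finset.mem_union, Finset.mem_Icc, Finset.mem_Ioc,
        Finset.mem_range, hpp, and_true] at hp hnot
      have : n.centralBinom.factorization p = 0 :=
        Nat.factorization_centralBinom_of_two_mul_self_lt_three_mul hn (by omega) (by omega)
      simp [hf, this]
    · exact hone p hpp
  have hA : ∏ p ∈ A, f p ≤ (2 * n) ^ Nat.sqrt (2 * n) := by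
    refine (Finset.prod_le_pow_card _ _ _ fun p _ => hle p).trans ?_
    refine Nat.pow_le_pow_right (by omega) ((Finset.card_filter_le _ _).trans ?_)
    simp
  have hB : ∏ p ∈ B, f p ≤ 4 ^ (2 * n / 3) := by
    refine le_trans ?_ (primorial_le_four_pow (2 * n / 3))
    refine (Finset.prod_le_prod' (g := fun p => p) fun p hp => ?_).trans
      (Finset.prod_le_prod_of_subset_of_one_le' (Finset.filter_subset _ _)
        fun p hp _ => (Finset.mem_filter.1 hp).2.one_lt.le)
    obtain ⟨h1, h2⟩ := Finset.mem_filter.1 hp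
    exact (Nat.pow_le_pow_right (Finset.mem_filter.1 h1).2.pos
      (Nat.factorization_choose_le_one (Nat.sqrt_lt'.mp h2))).trans (pow_one p).le
  have hC : ∏ p ∈ C, f p ≤ (2 * n) ^ C.card :=
    Finset.prod_le_pow_card _ _ _ fun p _ => hle p
  have hunion : ∀ s t : Finset ℕ, (∀ p ∈ s ∪ t, p.Prime) →
      ∏ p ∈ s ∪ t, f p ≤ (∏ p ∈ s, f p) * ∏ p ∈ t, f p := fun s t h => by
    rw [← Finset.prod_union_inter]
    exact Nat.le_mul_of_pos_right _
      (Finset.prod_pos fun p hp => hpos p (h p (Finset.mem_union_left _ (Finset.mem_inter.1 hp).1)))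
  have hAp : ∀ p ∈ A, p.Prime := fun p hp => (Finset.mem_filter.1 hp).2
  have hBp : ∀ p ∈ B, p.Prime := fun p hp => (Finset.mem_filter.1 (Finset.mem_filter.1 hp).1).2
  have hCp : ∀ p ∈ C, p.Prime := fun p hp => (Finset.mem_filter.1 hp).2
  have hABp : ∀ p ∈ A ∪ B, p.Prime := fun p hp => (Finset.mem_union.1 hp).elim (hAp p) (hBp p)
  have hABCp : ∀ p ∈ A ∪ B ∪ C, p.Prime :=
    fun p hp => (Finset.mem_union.1 hp).elim (hABp p) (hCp p)
  calc n.centralBinom ≤ ∏ p ∈ A ∪ B ∪ C, f p := by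
        conv_lhs => rw [hprod]
        exact Finset.prod_le_prod_of_subset_of_one_le' (Finset.filter_subset _ _)
          fun p hp _ => hpos p (hABCp p hp)
    _ ≤ (∏ p ∈ A ∪ B, f p) * ∏ p ∈ C, f p := hunion _ _ hABCp
    _ ≤ ((∏ p ∈ A, f p) * ∏ p ∈ B, f p) * ∏ p ∈ C, f p := by
        gcongr; exact hunion _ _ hABp
    _ ≤ _ := by gcongr

theorem eventually_mul_pow_le_card_primes (k : ℕ) (hk : 1 ≤ k) (C : ℕ) :
    ∀ᶠ j : ℕ in Filter.atTop, C * j ^ k ≤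
      ((Finset.Ioc (j ^ (k + 1)) (2 * j ^ (k + 1))).filter Nat.Prime).card := by
  have hev := (tendsto_natCast_atTop_atTop (R := ℝ)).eventually
    (Filter.eventually_gt_atTop ((3 * (2 * (k + 1) + 1) * (3 + C) : ℝ) ^ 2))
  filter_upwards [hev, Filter.eventually_ge_atTop 4] with j hj hj4
  by_contra! hlt
  set n := j ^ (k + 1) with hn
  set c := ((Finset.Ioc n (2 * n)).filter Nat.Prime).card
  have hn4 : 4 ≤ n := hj4.trans (Nat.le_self_pow (by omega) j)
  have hnat : 4 ^ n ≤ (2 * n) ^ (1 + Nat.sqrt (2 * n) + c) * 4 ^ (2 * n / 3) := by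
    have h1 := (Nat.four_pow_lt_mul_centralBinom n hn4).le
    have h2 := centralBinom_le_mul_pow_card_primes (n := n) (by omega)
    calc 4 ^ n ≤ n * n.centralBinom := h1
      _ ≤ (2 * n) * ((2 * n) ^ Nat.sqrt (2 * n) * 4 ^ (2 * n / 3) * (2 * n) ^ c) := by
          gcongr; omega
      _ = _ := by ring
  have hj0 : (0 : ℝ) < j := by positivity
  have hj1 : (1 : ℝ) ≤ j := by exact_mod_cast (by omega : 1 ≤ j)
  have hlog : (n : ℝ) * Real.log 4 ≤
      (1 + Nat.sqrt (2 * n) + c : ℝ) * Real.log (2 * n) + (2 * n / 3 : ℝ) * Real.log 4 := by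
    have h := Real.log_le_log (by positivity) (by exact_mod_cast hnat :
      ((4 : ℝ) ^ n ≤ (2 * n : ℝ) ^ (1 + Nat.sqrt (2 * n) + c) * 4 ^ (2 * n / 3)))
    rw [Real.log_mul (by positivity) (by positivity), Real.log_pow, Real.log_pow,
      Real.log_pow] at h
    push_cast at h
    have h3 : ((2 * n / 3 : ℕ) : ℝ) ≤ 2 * n / 3 := by
      have := Nat.cast_div_le (α := ℝ) (m := 2 * n) (n := 3)
      push_cast at this; exact this
    have h4 : 0 ≤ Real.log 4 := Real.log_nonneg (by norm_num)
    nlinarith [mul_le_mul_of_nonneg_right h3 h4]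
  have hlog4 : 1 ≤ Real.log 4 := by
    rw [Real.le_log_iff_exp_le (by norm_num)]
    linarith [Real.exp_one_lt_d9]
  have hs1 : 1 ≤ √(j : ℝ) := Real.one_le_sqrt.2 hj1
  have hL : Real.log (2 * n) ≤ (2 * (k + 1) + 1) * √(j : ℝ) := by
    rw [Real.log_mul (by norm_num) (by positivity), hn, Nat.cast_pow, Real.log_pow]
    have h2 : Real.log 2 ≤ 1 := by linarith [Real.log_two_lt_d9]
    have h3 : Real.log j ≤ 2 * √(j : ℝ) := by
      have := Real.log_le_sub_one_of_pos (Real.sqrt_pos.2 hj0)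
      rw [Real.log_sqrt hj0.le] at this
      linarith
    push_cast
    nlinarith [mul_le_mul_of_nonneg_left h3 (by positivity : (0 : ℝ) ≤ k + 1)]
  have hsq : Nat.sqrt (2 * n) ≤ 2 * j ^ k := by
    rw [← Nat.lt_succ_iff, Nat.sqrt_lt']
    calc 2 * n ≤ 4 * j ^ (2 * k) := by
          have : n ≤ j ^ (2 * k) := Nat.pow_le_pow_right (by omega) (by omega)
          omega
      _ = (2 * j ^ k) ^ 2 := by ring
      _ < _ := Nat.pow_lt_pow_left (Nat.lt_succ_self _) (by norm_num)
  have hE : (1 + Nat.sqrt (2 * n) + c : ℝ) ≤ (3 + C) * (j : ℝ) ^ k := by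
    have : 1 + Nat.sqrt (2 * n) + c ≤ (3 + C) * j ^ k := by
      have := Nat.one_le_pow k j (by omega)
      nlinarith
    exact_mod_cast this
  have hsj : 3 * (2 * (k + 1) + 1) * (3 + C) < √(j : ℝ) := Real.lt_sqrt_of_sq_lt hj
  have hL0 : 0 ≤ Real.log (2 * n : ℝ) :=
    Real.log_nonneg (by exact_mod_cast (by omega : 1 ≤ 2 * n))
  have hnj : (n : ℝ) = (j : ℝ) ^ k * (√(j : ℝ) * √(j : ℝ)) := by
    rw [Real.mul_self_sqrt hj0.le, hn]; push_cast; ring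
  have h1 : (n : ℝ) / 3 ≤ ((3 + C) * (j : ℝ) ^ k) * ((2 * (k + 1) + 1) * √(j : ℝ)) := by
    calc (n : ℝ) / 3 ≤ (n : ℝ) / 3 * Real.log 4 := le_mul_of_one_le_right (by positivity) hlog4
      _ ≤ (1 + Nat.sqrt (2 * n) + c : ℝ) * Real.log (2 * n) := by linarith
      _ ≤ _ := by gcongr
  have h2 : (0 : ℝ) < (j : ℝ) ^ k * √(j : ℝ) := by positivity
  rw [hnj] at h1
  nlinarith [mul_lt_mul_of_pos_left hsj h2]

theorem card_norm_add_div_le {q b : ℕ} (hq : 0 < q) (hb : q.Coprime b) (r : ℝ) (hr : 0 ≤ r)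
    (y : UnitAddCircle) :
    (((Finset.range q).filter
      fun j : ℕ => ‖y + (((b * j : ℕ) / q : ℝ) : UnitAddCircle)‖ ≤ r).card : ℝ) ≤ 2 * r * q + 1 := by
  obtain ⟨t, rfl⟩ := QuotientAddGroup.mk_surjective y
  have hq' : (0 : ℝ) < q := by exact_mod_cast hq
  let m : ℕ → ℤ := fun j => (b * j : ℕ) - q * round (t + ((b * j : ℕ) / q : ℝ))
  have hcard : ((Finset.range q).filter
      fun j : ℕ => ‖(t : UnitAddCircle) + (((b * j : ℕ) / q : ℝ) : UnitAddCircle)‖ ≤ r).card ≤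
      (Finset.Icc ⌈-q * t - q * r⌉ ⌊-q * t + q * r⌋).card := by
    apply Finset.card_le_card_of_injOn m
    · intro j hj
      have h := (Finset.mem_filter.1 hj).2
      rw [← QuotientAddGroup.mk_add] at h
      change ‖((t + ((b * j : ℕ) / q : ℝ) : ℝ) : UnitAddCircle)‖ ≤ r at h
      rw [UnitAddCircle.norm_eq] at h
      have h' : |q * t + m j| ≤ q * r := by
        have : q * t + m j = q * (t + ((b * j : ℕ) / q : ℝ) -
            round (t + ((b * j : ℕ) / q : ℝ))) := by
          simp only [m]; push_cast; field_simp; ring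
        rw [this, abs_mul, abs_of_pos hq']
        gcongr
      rw [abs_le] at h'
      simp only [Finset.coe_Icc, Set.mem_Icc, Int.ceil_le, Int.le_floor]
      constructor <;> linarith [h'.1, h'.2]
    · intro i hi j hj hij
      have hi' := Finset.mem_range.1 (Finset.mem_filter.1 hi).1
      have hj' := Finset.mem_range.1 (Finset.mem_filter.1 hj).1
      have hmod : b * i ≡ b * j [MOD q] := by
        rw [← Int.natCast_modEq_iff, Int.modEq_iff_dvd]
        refine ⟨round (t + ((b * j : ℕ) / q : ℝ)) - round (t + ((b * i : ℕ) / q : ℝ)), ?_⟩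
        simp only [m] at hij
        linarith
      exact Nat.ModEq.eq_of_lt_of_lt (Nat.ModEq.cancel_left_of_coprime hb hmod) hi' hj'
  rw [Int.card_Icc] at hcard
  have h2 : (((⌊-q * t + q * r⌋ + 1 - ⌈-q * t - q * r⌉).toNat : ℤ) : ℝ) ≤ 2 * r * q + 1 := by
    rw [Int.toNat_eq_max]
    push_cast
    apply max_le
    · linarith [Int.floor_le (-q * t + q * r), Int.le_ceil (-q * t - q * r)]
    · positivity
  exact le_trans (by exact_mod_cast hcard) h2

theorem volume_norm_nsmul_le {q : ℕ} (hq : 1 < q) {r : ℝ} (hr : r ≤ 1 / 2) :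
    volume {x : UnitAddCircle | ‖q • x‖ ≤ r} = ENNReal.ofReal (2 * r) := by
  have h := (AddCircle.ergodic_nsmul (T := 1) hq).toMeasurePreserving.measure_preimage
    (s := Metric.closedBall 0 r) Metric.isClosed_closedBall.measurableSet.nullMeasurableSet
  rw [AddCircle.volume_closedBall, min_eq_right (by linarith)] at h
  rw [← h]
  congr 1
  ext x
  simp

theorem measurableSet_norm_nsmul_le (q : ℕ) (r : ℝ) :
    MeasurableSet {x : UnitAddCircle | ‖q • x‖ ≤ r} :=
  (isClosed_le (by fun_prop) continuous_const).measurableSet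

theorem volume_norm_nsmul_le_inter_le {p q : ℕ} (hq : 1 < q) (hpq : q.Coprime p)
    {r : ℝ} (hr : 0 ≤ r) (hr' : r ≤ 1 / 2) :
    volume ({x : UnitAddCircle | ‖q • x‖ ≤ r} ∩ {x | ‖p • x‖ ≤ r}) ≤
      ENNReal.ofReal (2 * r * (2 * r + 1 / q)) := by
  have hq' : (0 : ℝ) < q := by exact_mod_cast (by omega : 0 < q)
  set A := {x : UnitAddCircle | ‖q • x‖ ≤ r} with hA
  let B : ℕ → Set UnitAddCircle :=
    fun j => {x | ‖p • x + (((p * j : ℕ) / q : ℝ) : UnitAddCircle)‖ ≤ r}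
  have hBm : ∀ j, MeasurableSet (B j) := fun j =>
    (isClosed_le (by fun_prop) continuous_const).measurableSet
  have hshift : ∀ j, volume (A ∩ B j) = volume (A ∩ {x | ‖p • x‖ ≤ r}) := fun j => by
    rw [← measure_preimage_add_right volume (((j : ℝ) / q : ℝ) : UnitAddCircle)
      (A ∩ {x | ‖p • x‖ ≤ r})]
    congr 1
    ext x
    have e1 : q • (((j : ℝ) / q : ℝ) : UnitAddCircle) = 0 := by
      rw [← AddCircle.coe_nsmul, nsmul_eq_mul, mul_div_cancel₀ _ hq'.ne']
      exact (AddCircle.coe_eq_zero_iff 1).2 ⟨j, by simp⟩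
    have e2 : p • (((j : ℝ) / q : ℝ) : UnitAddCircle) =
        (((p * j : ℕ) / q : ℝ) : UnitAddCircle) := by
      rw [← AddCircle.coe_nsmul, nsmul_eq_mul]
      push_cast
      rw [mul_div_assoc]
    simp only [hA, B, Set.mem_inter_iff, Set.mem_ofPred_eq, Set.mem_preimage, nsmul_add, e1, e2,
      add_zero]
  have hsum : (q : ENNReal) * volume (A ∩ {x | ‖p • x‖ ≤ r}) ≤
      ENNReal.ofReal (2 * r * q + 1) * ENNReal.ofReal (2 * r) := by
    calc (q : ENNReal) * volume (A ∩ {x | ‖p • x‖ ≤ r})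
        = ∑ j ∈ Finset.range q, volume (A ∩ B j) := by simp [hshift]
      _ = ∑ j ∈ Finset.range q, ∫⁻ x in A, (B j).indicator 1 x := by
          refine Finset.sum_congr rfl fun j _ => ?_
          rw [lintegral_indicator_one (hBm j), Measure.restrict_apply (hBm j), Set.inter_comm]
      _ = ∫⁻ x in A, ∑ j ∈ Finset.range q, (B j).indicator 1 x :=
          (lintegral_finsetSum _ fun j _ => measurable_one.indicator (hBm j)).symm
      _ ≤ ∫⁻ _ in A, ENNReal.ofReal (2 * r * q + 1) := by
          refine lintegral_mono fun x => ?_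
          have h := card_norm_add_div_le (by omega) hpq r hr (p • x)
          have e : ∑ j ∈ Finset.range q, (B j).indicator (1 : UnitAddCircle → ENNReal) x =
              (((Finset.range q).filter fun j : ℕ =>
                ‖p • x + (((p * j : ℕ) / q : ℝ) : UnitAddCircle)‖ ≤ r).card : ENNReal) := by
            simp [B, Set.indicator_apply]
          rw [e, ← ENNReal.ofReal_natCast]
          exact ENNReal.ofReal_le_ofReal h
      _ = _ := by
          rw [lintegral_const, Measure.restrict_apply_univ, volume_norm_nsmul_le hq hr']
  rw [← ENNReal.ofReal_natCast, mul_comm, ← ENNReal.le_div_iff_mul_le (Or.inl (by simpa using by omega))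
      (Or.inl (by simp)),
    ← ENNReal.ofReal_mul (by positivity), ← ENNReal.ofReal_div_of_pos hq'] at hsum
  refine hsum.trans_eq (congrArg _ ?_)
  field_simp

/-- Second moment bound for the probability that none of the events `A i` occurs. -/
theorem measureReal_iInter_compl_le {Ω ι : Type*} [MeasurableSpace Ω] (μ : Measure Ω)
    [IsProbabilityMeasure μ] (s : Finset ι) (A : ι → Set Ω) (hA : ∀ i, MeasurableSet (A i))
    {p ε : ℝ} (hε : 0 ≤ ε) (hp : 0 < p) (hs : s.Nonempty) (h1 : ∀ i ∈ s, μ.real (A i) = p)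
    (h2 : ∀ i ∈ s, ∀ j ∈ s, i ≠ j → μ.real (A i ∩ A j) ≤ p * (p + ε)) :
    μ.real {x | ∀ i ∈ s, x ∉ A i} ≤ (1 + s.card * ε) / (s.card * p) := by
  classical
  set n : ℝ := (s.card : ℝ) with hndef
  have hn : 0 < n := by simpa [hndef] using hs
  let S : Ω → ℝ := fun x => ∑ i ∈ s, (A i).indicator 1 x
  have hind : ∀ B, MeasurableSet B → Integrable (B.indicator (1 : Ω → ℝ)) μ :=
    fun B hB => (integrable_const 1).indicator hB
  have hS : Integrable S μ := integrable_finsetSum _ fun i _ => hind _ (hA i)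
  have hSS : ∀ x, S x * S x = ∑ i ∈ s, ∑ j ∈ s, (A i ∩ A j).indicator 1 x := fun x => by
    simp only [S, Finset.sum_mul_sum, Set.inter_indicator_one, Pi.mul_apply]
  have hSSi : Integrable (fun x => S x * S x) μ := by
    simp only [hSS]
    exact integrable_finsetSum _ fun i _ => integrable_finsetSum _
      fun j _ => hind _ ((hA i).inter (hA j))
  have hES : ∫ x, S x ∂μ = n * p := by
    simp only [S]
    rw [integral_finsetSum _ fun i _ => hind _ (hA i)]
    simp_rw [integral_indicator_one (hA _)]
    rw [Finset.sum_congr rfl h1]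
    simp [n]
  have hESS : ∫ x, S x * S x ∂μ ≤ n * (p + n * (p * (p + ε))) := by
    simp only [hSS]
    rw [integral_finsetSum _ fun i _ => integrable_finsetSum _
      fun j _ => hind _ ((hA i).inter (hA j))]
    rw [← nsmul_eq_mul]
    refine Finset.sum_le_card_nsmul _ _ _ fun i hi => ?_
    rw [integral_finsetSum _ fun j _ => hind _ ((hA i).inter (hA j))]
    simp_rw [integral_indicator_one ((hA _).inter (hA _))]
    rw [← Finset.add_sum_erase _ _ hi, Set.inter_self, h1 i hi]
    gcongr
    refine (Finset.sum_le_card_nsmul _ _ (p * (p + ε)) fun j hj =>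
      h2 i hi j (Finset.mem_of_mem_erase hj) (Finset.ne_of_mem_erase hj).symm).trans ?_
    rw [nsmul_eq_mul]
    gcongr
    exact Nat.cast_le.2 Finset.card_erase_le
  have e : ∀ x, (S x - n * p) ^ 2 = S x * S x - 2 * (n * p) * S x + (n * p) ^ 2 :=
    fun x => by ring
  have hSi : Integrable (fun x => 2 * (n * p) * S x) μ := hS.const_mul _
  have hdi : Integrable (fun x => S x * S x - 2 * (n * p) * S x) μ := hSSi.sub hSi
  have hvi : Integrable (fun x => (S x - n * p) ^ 2) μ := by
    simp only [e]
    exact hdi.add (integrable_const _)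
  have hvar : ∫ x, (S x - n * p) ^ 2 ∂μ ≤ n * p * (1 + n * ε) := by
    simp only [e]
    rw [integral_add hdi (integrable_const _), integral_sub hSSi hSi, integral_const_mul, hES,
      integral_const]
    simp only [probReal_univ, one_smul]
    nlinarith
  have hM := mul_meas_ge_le_integral_of_nonneg (μ := μ)
    (Filter.Eventually.of_forall fun x => sq_nonneg (S x - n * p)) hvi ((n * p) ^ 2)
  have hsub : μ.real {x | ∀ i ∈ s, x ∉ A i} ≤ μ.real {x | (n * p) ^ 2 ≤ (S x - n * p) ^ 2} := by
    refine measureReal_mono fun x hx => ?_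
    have : S x = 0 := Finset.sum_eq_zero fun i hi => Set.indicator_of_notMem (hx i hi) _
    simp [this]
  rw [le_div_iff₀ (by positivity)]
  have h3 := (mul_le_mul_of_nonneg_left hsub (sq_nonneg (n * p))).trans (hM.trans hvar)
  have hnp : 0 < n * p := by positivity
  nlinarith

theorem succ_pow_succ_le (k j : ℕ) (hj : 1 ≤ j) :
    (j + 1) ^ (k + 1) ≤ j ^ (k + 1) + 3 ^ (k + 1) * j ^ k := by
  induction k with
  | zero => simp
  | succ k ih =>
    have h1 : j ^ k ≤ j ^ (k + 1) := Nat.pow_le_pow_right hj (Nat.le_succ k)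
    have h2 : 1 ≤ 3 ^ (k + 1) := Nat.one_le_pow _ _ (by norm_num)
    calc (j + 1) ^ (k + 1 + 1) = (j + 1) ^ (k + 1) * (j + 1) := pow_succ _ _
      _ ≤ (j ^ (k + 1) + 3 ^ (k + 1) * j ^ k) * (j + 1) := Nat.mul_le_mul_right _ ih
      _ = j ^ (k + 1 + 1) + j ^ (k + 1) + 3 ^ (k + 1) * j ^ (k + 1) + 3 ^ (k + 1) * j ^ k := by
          ring
      _ ≤ j ^ (k + 1 + 1) + 3 ^ (k + 1) * j ^ (k + 1) + 3 ^ (k + 1) * j ^ (k + 1) +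
          3 ^ (k + 1) * j ^ (k + 1) := by
          have h3 := Nat.mul_le_mul_left (3 ^ (k + 1)) h1
          have h4 := Nat.mul_le_mul_right (j ^ (k + 1)) h2
          omega
      _ = _ := by ring

theorem eventually_pow_le_card_primes_Icc (k : ℕ) (hk : 1 ≤ k) :
    ∀ᶠ j : ℕ in Filter.atTop, j ^ k ≤
      ((Finset.Icc ((j + 1) ^ (k + 1)) (2 * j ^ (k + 1))).filter Nat.Prime).card := by
  filter_upwards [eventually_mul_pow_le_card_primes k hk (3 ^ (k + 1) + 1),
    Filter.eventually_ge_atTop 1] with j hj hj1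
  have hsub : (Finset.Ioc (j ^ (k + 1)) (2 * j ^ (k + 1))).filter Nat.Prime ⊆
      (Finset.Ico (j ^ (k + 1)) ((j + 1) ^ (k + 1))) ∪
      (Finset.Icc ((j + 1) ^ (k + 1)) (2 * j ^ (k + 1))).filter Nat.Prime := by
    intro p
    simp only [Finset.mem_filter, Finset.mem_union, Finset.mem_Ioc, Finset.mem_Ico,
      Finset.mem_Icc]
    rintro ⟨⟨h1, h2⟩, h3⟩
    rcases lt_or_ge p ((j + 1) ^ (k + 1)) with h | h
    · exact Or.inl ⟨h1.le, h⟩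
    · exact Or.inr ⟨⟨h, h2⟩, h3⟩
  have h1 := (Finset.card_le_card hsub).trans (Finset.card_union_le _ _)
  rw [Nat.card_Ico] at h1
  have h2 := succ_pow_succ_le k j hj1
  rw [add_mul, one_mul] at hj
  omega

/-- If primes `q ≥ M` are taken from a set `P` of at most `2 * M` elements, then the set of
points with all `‖q • x‖ > r` has measure `O(1 / (r * #P))`. -/
theorem measureReal_forall_lt_norm_nsmul_le {P : Finset ℕ} {M : ℕ} (hP : ∀ q ∈ P, q.Prime)
    (hM : 0 < M) (hPM : ∀ q ∈ P, M ≤ q) (hcard : P.card ≤ 2 * M) (hne : P.Nonempty)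
    {r : ℝ} (hr : 0 < r) (hr' : r ≤ 1 / 2) :
    volume.real {x : UnitAddCircle | ∀ q ∈ P, r < ‖q • x‖} ≤ 3 / (P.card * (2 * r)) := by
  have hM' : (0 : ℝ) < M := by exact_mod_cast hM
  have : IsProbabilityMeasure (volume : Measure UnitAddCircle) := ⟨UnitAddCircle.measure_univ⟩
  have h := measureReal_iInter_compl_le (volume : Measure UnitAddCircle) P
    (fun q => {x | ‖q • x‖ ≤ r}) (fun q => measurableSet_norm_nsmul_le q r)
    (p := 2 * r) (ε := 1 / M) (by positivity) (by positivity) hne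
    (fun q hq => by
      rw [measureReal_def, volume_norm_nsmul_le (hP q hq).one_lt hr',
        ENNReal.toReal_ofReal (by positivity)])
    (fun q hq p hp hne => by
      rw [measureReal_def]
      have hle : 2 * r * (2 * r + 1 / (q : ℝ)) ≤ 2 * r * (2 * r + 1 / M) := by
        have : (M : ℝ) ≤ q := by exact_mod_cast hPM q hq
        gcongr
      refine ENNReal.toReal_le_of_le_ofReal (by positivity) ?_
      exact (volume_norm_nsmul_le_inter_le (hP q hq).one_lt
        ((Nat.coprime_primes (hP q hq) (hP p hp)).2 hne) hr.le hr').trans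
        (ENNReal.ofReal_le_ofReal hle))
  simp only [Set.mem_ofPred_eq, not_le] at h
  refine h.trans ?_
  gcongr
  have : (P.card : ℝ) * (1 / M) ≤ 2 := by
    rw [mul_one_div, div_le_iff₀ hM']
    exact_mod_cast hcard
  linarith

theorem abs_sfrac_eq_norm (x : ℝ) : |sfrac x| = ‖(x : UnitAddCircle)‖ := by
  have h : ((sfrac x : ℝ) : UnitAddCircle) = x := by
    rw [← sub_eq_zero, ← AddCircle.coe_sub, AddCircle.coe_eq_zero_iff]
    exact ⟨⌊1 / 2 - x⌋, by simp only [sfrac, Int.fract, zsmul_eq_mul]; ring⟩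
  rw [← h, eq_comm]
  apply (AddCircle.norm_coe_eq_abs_iff 1 one_ne_zero).2
  have h1 := Int.fract_lt_one (1 / 2 - x)
  rw [sfrac, abs_le]
  constructor
  · norm_num
    linarith
  · norm_num

theorem ae_eventually_exists_prime_norm_nsmul_lt {δ : ℝ} (hδ : 0 < δ) {k : ℕ} (hk : 1 ≤ k)
    (hkδ : (k + 1) * δ ≤ k - 2) :
    ∀ᵐ x : UnitAddCircle, ∀ᶠ j : ℕ in Filter.atTop, ∃ q : ℕ, q.Prime ∧
      (j + 1) ^ (k + 1) ≤ q ∧ q ≤ 2 * j ^ (k + 1) ∧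
      ‖q • x‖ < (((j + 1) ^ (k + 1) : ℕ) : ℝ) ^ (-δ) := by
  obtain ⟨j₀, hj₀⟩ := Filter.eventually_atTop.1 (eventually_pow_le_card_primes_Icc k hk)
  let P : ℕ → Finset ℕ :=
    fun j => (Finset.Icc ((j + 1) ^ (k + 1)) (2 * j ^ (k + 1))).filter Nat.Prime
  let ψ : ℕ → ℝ := fun j => (((j + 1) ^ (k + 1) : ℕ) : ℝ) ^ (-δ)
  let E : ℕ → Set UnitAddCircle := fun j => {x | ∀ q ∈ P j, ψ j / 2 < ‖q • x‖}
  let i : ℕ → ℕ := fun n => n + (j₀ + 1)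
  have hbound : ∀ n, volume (E (i n)) ≤
      ENNReal.ofReal (3 * 2 ^ (k + 1) * (1 / ((i n : ℕ) : ℝ) ^ 2)) := by
    intro n
    have hj1 : 1 ≤ i n := by simp [i]; omega
    have hcardP : (i n) ^ k ≤ (P (i n)).card := hj₀ _ (by simp only [i]; omega)
    generalize i n = j at *
    have hjR : (1 : ℝ) ≤ j := by exact_mod_cast hj1
    have hpow : 0 < j ^ k := by positivity
    have hψ0 : 0 < ψ j := by positivity
    have hψ1 : ψ j ≤ 1 :=
      Real.rpow_le_one_of_one_le_of_nonpos
        (by exact_mod_cast Nat.one_le_pow _ _ (Nat.succ_pos j)) (by linarith)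
    have h := measureReal_forall_lt_norm_nsmul_le (P := P j) (M := (j + 1) ^ (k + 1))
      (fun q hq => (Finset.mem_filter.1 hq).2) (by positivity)
      (fun q hq => (Finset.mem_Icc.1 (Finset.mem_filter.1 hq).1).1)
      (by
        refine (Finset.card_filter_le _ _).trans ?_
        rw [Nat.card_Icc]
        have h1 : j ^ (k + 1) ≤ (j + 1) ^ (k + 1) := Nat.pow_le_pow_left (Nat.le_succ j) _
        have h2 : 1 ≤ (j + 1) ^ (k + 1) := Nat.one_le_pow _ _ (Nat.succ_pos j)
        omega)
      (Finset.card_pos.1 (hpow.trans_le hcardP)) (r := ψ j / 2) (by positivity) (by linarith)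
    rw [← ENNReal.ofReal_toReal (measure_ne_top volume (E j))]
    refine ENNReal.ofReal_le_ofReal (h.trans ?_)
    have hψlow : 1 / (2 ^ (k + 1) * (j : ℝ) ^ k) * (j : ℝ) ^ 2 ≤ ψ j := by
      have e : ψ j = ((j + 1 : ℕ) : ℝ) ^ (-((k + 1) * δ)) := by
        simp only [ψ]
        rw [Nat.cast_pow, ← Real.rpow_natCast, ← Real.rpow_mul (by positivity)]
        push_cast
        ring_nf
      have hb : (1 : ℝ) ≤ ((j + 1 : ℕ) : ℝ) := by push_cast; linarith
      calc 1 / (2 ^ (k + 1) * (j : ℝ) ^ k) * (j : ℝ) ^ 2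
          = (j : ℝ) ^ 3 / (2 * j) ^ (k + 1) := by
            rw [mul_pow, pow_succ (j : ℝ) k]; field_simp
        _ ≤ ((j + 1 : ℕ) : ℝ) ^ 3 / ((j + 1 : ℕ) : ℝ) ^ (k + 1) := by
            gcongr
            · simp
            · push_cast; linarith
        _ = ((j + 1 : ℕ) : ℝ) ^ (-((k : ℝ) - 2)) := by
            rw [← Real.rpow_natCast, ← Real.rpow_natCast, ← Real.rpow_sub (by positivity)]
            push_cast
            ring_nf
        _ ≤ ψ j := by
            rw [e]
            exact Real.rpow_le_rpow_of_exponent_le hb (by linarith)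
    have hcR : (j : ℝ) ^ k ≤ (P j).card := by exact_mod_cast hcardP
    have hprod : (j : ℝ) ^ 2 / 2 ^ (k + 1) ≤ (P j).card * (2 * (ψ j / 2)) := by
      calc (j : ℝ) ^ 2 / 2 ^ (k + 1)
          = (j : ℝ) ^ k * (1 / (2 ^ (k + 1) * (j : ℝ) ^ k) * (j : ℝ) ^ 2) := by field_simp
        _ ≤ (P j).card * ψ j := by gcongr
        _ = _ := by ring
    calc 3 / ((P j).card * (2 * (ψ j / 2))) ≤ 3 / ((j : ℝ) ^ 2 / 2 ^ (k + 1)) := by gcongr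
      _ = _ := by field_simp
  have hsummable : Summable fun n => 3 * 2 ^ (k + 1) * (1 / ((i n : ℕ) : ℝ) ^ 2) :=
    ((summable_nat_add_iff (f := fun n : ℕ => 1 / (n : ℝ) ^ 2) (j₀ + 1)).2
      (Real.summable_one_div_nat_pow.2 one_lt_two)).mul_left _
  have hae := ae_eventually_notMem (μ := volume) (s := fun n => E (i n))
    (ne_top_of_le_ne_top hsummable.tsum_ofReal_ne_top (ENNReal.tsum_le_tsum hbound))
  filter_upwards [hae] with x hx
  rw [Filter.eventually_atTop] at hx ⊢
  obtain ⟨n₀, hn₀⟩ := hx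
  refine ⟨n₀ + (j₀ + 1), fun j hj => ?_⟩
  have hnot := hn₀ (j - (j₀ + 1)) (by omega)
  rw [show i (j - (j₀ + 1)) = j by simp only [i]; omega] at hnot
  simp only [E, Set.mem_ofPred_eq, not_forall, not_lt] at hnot
  obtain ⟨q, hq, hqx⟩ := hnot
  obtain ⟨hq1, hq2⟩ := Finset.mem_filter.1 hq
  obtain ⟨hq3, hq4⟩ := Finset.mem_Icc.1 hq1
  have hψ0 : 0 < ψ j := by positivity
  exact ⟨q, hq2, hq3, hq4, hqx.trans_lt (half_lt_self hψ0)⟩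

theorem prime_denominator_approximation (η : ℝ) (hη : η ∈ Set.Ioo (0:ℝ) 1) :
    ∀ᵐ α ∂(volume.restrict (Set.Icc (0:ℝ) 1)),
      ∃ N₀ : ℕ, ∀ N : ℕ, N₀ ≤ N →
        ∃ q : ℕ, q.Prime ∧ N ≤ q ∧ q ≤ 2 * N ∧
          |sfrac ((q : ℝ) * α)| < (N : ℝ) ^ (-(1 - η)) := by
  obtain ⟨hη0, hη1⟩ := hη
  obtain ⟨k, hk⟩ := exists_nat_ge (3 / η)
  have hkη : 3 ≤ k * η := (div_le_iff₀ hη0).1 hk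
  have hk1 : 1 ≤ k := by
    rcases Nat.eq_zero_or_pos k with rfl | h
    · norm_num at hkη
    · exact h
  have hae := ae_eventually_exists_prime_norm_nsmul_lt (δ := 1 - η) (by linarith) hk1
    (by nlinarith)
  rw [← restrict_Ioc_eq_restrict_Icc]
  have hmk := UnitAddCircle.measurePreserving_mk 0
  rw [zero_add] at hmk
  filter_upwards [hmk.quasiMeasurePreserving.ae hae] with α hα
  obtain ⟨j₀, hj₀⟩ := Filter.eventually_atTop.1 hα
  refine ⟨(j₀ + 1) ^ (k + 1), fun N hN => ?_⟩
  let j := Nat.findGreatest (fun j => j ^ (k + 1) ≤ N) N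
  have hj0N : j₀ + 1 ≤ N := (Nat.le_self_pow (Nat.succ_ne_zero k) _).trans hN
  have hj : j ^ (k + 1) ≤ N :=
    Nat.findGreatest_spec (P := fun j => j ^ (k + 1) ≤ N) hj0N hN
  have hjj : j₀ + 1 ≤ j := Nat.le_findGreatest hj0N hN
  have hj' : N < (j + 1) ^ (k + 1) := by
    by_contra! h
    exact absurd (Nat.le_findGreatest (P := fun j => j ^ (k + 1) ≤ N)
      ((Nat.le_self_pow (Nat.succ_ne_zero k) _).trans h) h) (Nat.not_succ_le_self j)
  obtain ⟨q, hq, h1, h2, h3⟩ := hj₀ j (by omega)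
  refine ⟨q, hq, hj'.le.trans h1, h2.trans (by omega), ?_⟩
  rw [abs_sfrac_eq_norm, ← nsmul_eq_mul, AddCircle.coe_nsmul]
  refine h3.trans_le (Real.rpow_le_rpow_of_nonpos ?_ ?_ (by linarith))
  · exact_mod_cast (by omega : 0 < N)
  · exact_mod_cast hj'.le
end

section
/- Let ε ∈ (0, 1/4). For Lebesgue-almost all α ∈ [0,1] there exists a constant C(α,ε) such that for every integer N ≥ 2, every real L with 1 ≤ L ≤ N^(1−ε), and every real s with 1/log N ≤ s ≤ log N, one has |R₂(α,L,N,1_{[−s,s]}) − 2Ls| ≤ C(α,ε)·L·s·N^(−ε/13). -/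
open MeasureTheory

/-- The pair correlation function `R₂(α,L,N,1_{[−s,s]})` for the dilated squares. -/
noncomputable def R2 (α L : ℝ) (N : ℕ) (s : ℝ) : ℝ :=
  (1 / (N : ℝ)) * ((Finset.Icc 1 N ×ˢ Finset.Icc 1 N).filter
    (fun p : ℕ × ℕ => p.1 ≠ p.2 ∧
      |sfrac (α * ((p.1 : ℝ)^2 - (p.2 : ℝ)^2))| ≤ s * L / N)).card

theorem succ_pow_le_pow_self_mul_two_pow (k a : ℕ) (hk : 0 < k) :
    (a + 1) ^ k ≤ k ^ k * 2 ^ a := by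
  have h1 : a + 1 ≤ k * (a / k + 1) := by
    have := Nat.div_add_mod a k
    have := Nat.mod_lt a hk
    rw [mul_add]; omega
  have h2 : a / k + 1 ≤ 2 ^ (a / k) := Nat.lt_two_pow_self
  calc (a + 1) ^ k ≤ (k * 2 ^ (a / k)) ^ k := by gcongr; exact h1.trans (by gcongr)
    _ = k ^ k * 2 ^ (a / k * k) := by rw [mul_pow, ← pow_mul]
    _ ≤ k ^ k * 2 ^ a := by
        gcongr
        · norm_num
        · exact Nat.div_mul_le_self a k

/-- The divisor bound `d(n) ≪ n ^ (1 / k)`. -/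
theorem exists_card_divisors_pow_le (k : ℕ) (hk : 0 < k) :
    ∃ C : ℕ, 0 < C ∧ ∀ n : ℕ, n ≠ 0 → n.divisors.card ^ k ≤ C * n := by
  have hK : 1 ≤ k ^ k := Nat.one_le_pow _ _ hk
  refine ⟨(k ^ k) ^ (2 ^ k), by positivity, fun n hn => ?_⟩
  have hprime : ∀ p ∈ n.primeFactors, (n.factorization p + 1) ^ k ≤
      (if p < 2 ^ k then k ^ k else 1) * p ^ n.factorization p := by
    intro p hp
    have hp2 : 2 ≤ p := (Nat.prime_of_mem_primeFactors hp).two_le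
    split_ifs with h
    · exact (succ_pow_le_pow_self_mul_two_pow k _ hk).trans (by gcongr)
    · rw [one_mul]
      calc (n.factorization p + 1) ^ k ≤ (2 ^ n.factorization p) ^ k := by
            gcongr; exact Nat.lt_two_pow_self
        _ = (2 ^ k) ^ n.factorization p := by rw [← pow_mul, ← pow_mul, mul_comm]
        _ ≤ _ := by gcongr; omega
  rw [Nat.card_divisors hn, ← Finset.prod_pow]
  refine (Finset.prod_le_prod' hprime).trans ?_
  rw [Finset.prod_mul_distrib]
  have hfac : ∏ p ∈ n.primeFactors, p ^ n.factorization p = n :=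
    Nat.prod_factorization_pow_eq_self hn
  rw [hfac]
  gcongr
  rw [Finset.prod_ite, Finset.prod_const, Finset.prod_const_one, mul_one]
  refine Nat.pow_le_pow_right hK ?_
  calc _ ≤ (Finset.range (2 ^ k)).card := Finset.card_le_card fun p hp => by
        simp only [Finset.mem_filter] at hp; simpa using hp.2
    _ = _ := Finset.card_range _

theorem sum_gcd_le_mul_card_divisors (M b : ℕ) (hb : b ≠ 0) :
    ∑ a ∈ Finset.Icc 1 M, a.gcd b ≤ M * b.divisors.card := by
  have h1 : ∀ a ∈ Finset.Icc 1 M, a.gcd b ≤ ∑ g ∈ b.divisors, if g ∣ a then g else 0 := by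
    intro a _
    have := Finset.single_le_sum (f := fun g => if g ∣ a then g else 0) (fun _ _ => Nat.zero_le _)
      (Nat.mem_divisors.2 ⟨Nat.gcd_dvd_right a b, hb⟩)
    simpa [Nat.gcd_dvd_left] using this
  refine (Finset.sum_le_sum h1).trans ?_
  rw [Finset.sum_comm, mul_comm, ← smul_eq_mul]
  refine Finset.sum_le_card_nsmul _ _ _ fun g _ => ?_
  rw [← Finset.sum_filter, Finset.sum_const, smul_eq_mul]
  have : ((Finset.Icc 1 M).filter (g ∣ ·)).card = M / g := Nat.Ioc_filter_dvd_card_eq_div M g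
  rw [this]
  exact Nat.div_mul_le_self M g

/-- Ordered pairs of distinct elements of `{1, …, N}`. -/
def distinctPairs (N : ℕ) : Finset (ℕ × ℕ) :=
  (Finset.Icc 1 N ×ˢ Finset.Icc 1 N).filter fun p => p.1 ≠ p.2

theorem card_distinctPairs (N : ℕ) : ((distinctPairs N).card : ℝ) = (N : ℝ) ^ 2 - N := by
  have h := Finset.offDiag_card (Finset.Icc 1 N)
  have h' : distinctPairs N = (Finset.Icc 1 N).offDiag := by
    ext p; simp [distinctPairs, Finset.mem_offDiag]; tauto
  rw [h', h, Nat.card_Icc, Nat.add_sub_cancel, Nat.cast_sub (Nat.le_mul_self N)]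
  push_cast; ring

/-- The difference of the squares of the entries of a pair. -/
def sqDiff (p : ℕ × ℕ) : ℤ := (p.1 : ℤ) ^ 2 - (p.2 : ℤ) ^ 2

theorem sqDiff_eq_mul (p : ℕ × ℕ) : sqDiff p = ((p.1 + p.2 : ℕ) : ℤ) * ((p.1 : ℤ) - p.2) := by
  rw [sqDiff]; push_cast; ring

theorem natAbs_sqDiff_mem {N : ℕ} {p : ℕ × ℕ} (hp : p ∈ distinctPairs N) :
    (sqDiff p).natAbs ∈ Finset.Icc 1 (N ^ 2) := by
  simp only [distinctPairs, Finset.mem_filter, Finset.mem_product, Finset.mem_Icc] at hp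
  obtain ⟨⟨⟨h1, h2⟩, h3, h4⟩, h5⟩ := hp
  rw [Finset.mem_Icc]
  constructor
  · rw [Nat.one_le_iff_ne_zero, Int.natAbs_ne_zero, sqDiff_eq_mul]
    exact mul_ne_zero (by omega) (by omega)
  · have e1 : (p.1 : ℤ) ^ 2 ≤ (N : ℤ) ^ 2 := by gcongr
    have e2 : (p.2 : ℤ) ^ 2 ≤ (N : ℤ) ^ 2 := by gcongr
    have : ((N ^ 2 : ℕ) : ℤ) = (N : ℤ) ^ 2 := by push_cast; rfl
    rw [sqDiff]
    have := sq_nonneg (p.1 : ℤ)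
    have := sq_nonneg (p.2 : ℤ)
    omega

theorem sqDiff_ne_zero {N : ℕ} {p : ℕ × ℕ} (hp : p ∈ distinctPairs N) : sqDiff p ≠ 0 := by
  have := natAbs_sqDiff_mem hp
  rw [Finset.mem_Icc] at this
  omega

theorem card_filter_natAbs_sqDiff_le (N k : ℕ) (hk : k ≠ 0) :
    ((distinctPairs N).filter fun p => (sqDiff p).natAbs = k).card ≤ 2 * k.divisors.card := by
  have h : (k.divisors ×ˢ (Finset.univ : Finset Bool)).card = 2 * k.divisors.card := by
    rw [Finset.card_product, mul_comm]; rfl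
  rw [← h]
  refine Finset.card_le_card_of_injOn (fun p => (p.1 + p.2, decide (p.1 < p.2))) ?_ ?_
  · intro p hp
    simp only [Finset.coe_filter, Set.mem_ofPred_eq] at hp
    simp only [Finset.coe_product, Set.mem_prod, Finset.mem_coe, Finset.mem_univ, and_true]
    refine Nat.mem_divisors.2 ⟨?_, hk⟩
    rw [← hp.2, sqDiff_eq_mul, Int.natAbs_mul, Int.natAbs_natCast]
    exact dvd_mul_right _ _
  · intro p hp q hq hpq
    simp only [Finset.coe_filter, Set.mem_ofPred_eq] at hp hq
    simp only [Prod.mk.injEq, decide_eq_decide] at hpq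
    obtain ⟨h1, h2⟩ := hpq
    have h3 := hp.2.trans hq.2.symm
    rw [sqDiff_eq_mul, sqDiff_eq_mul, Int.natAbs_mul, Int.natAbs_mul, h1] at h3
    have h4 : 0 < q.1 + q.2 := by
      have := hq.1
      simp only [distinctPairs, Finset.mem_filter, Finset.mem_product, Finset.mem_Icc] at this
      omega
    have h5 := Nat.eq_of_mul_eq_mul_left h4 (by simpa only [Int.natAbs_natCast] using h3)
    ext <;> omega

theorem sum_natAbs_sqDiff_le (N : ℕ) (f : ℕ → ℝ) (hf : ∀ k, 0 ≤ f k) :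
    ∑ p ∈ distinctPairs N, f (sqDiff p).natAbs ≤
      ∑ k ∈ Finset.Icc 1 (N ^ 2), (2 * (k.divisors.card : ℝ)) * f k := by
  rw [← Finset.sum_fiberwise_of_maps_to (fun p hp => natAbs_sqDiff_mem (N := N) hp)]
  refine Finset.sum_le_sum fun k hk => ?_
  rw [Finset.sum_congr rfl fun p hp => by rw [(Finset.mem_filter.1 hp).2], Finset.sum_const,
    nsmul_eq_mul]
  refine mul_le_mul_of_nonneg_right ?_ (hf k)
  have := card_filter_natAbs_sqDiff_le N k (by rw [Finset.mem_Icc] at hk; omega)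
  exact_mod_cast this

theorem sum_gcd_div_le (N : ℕ) (D : ℝ)
    (hD : ∀ k ∈ Finset.Icc 1 (N ^ 2), (k.divisors.card : ℝ) ≤ D) :
    ∑ p ∈ distinctPairs N, ∑ q ∈ distinctPairs N,
      ((sqDiff p).natAbs.gcd (sqDiff q).natAbs : ℝ) / (sqDiff q).natAbs ≤
      4 * D ^ 3 * N ^ 2 * (1 + Real.log (N ^ 2 : ℕ)) := by
  rcases Nat.eq_zero_or_pos N with rfl | hN
  · simp [distinctPairs]
  have hD0 : 0 ≤ D := (Nat.cast_nonneg _).trans (hD 1 (by simp; exact Nat.one_le_pow _ _ hN))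
  have inner : ∀ b ∈ Finset.Icc 1 (N ^ 2), ∑ p ∈ distinctPairs N,
      ((sqDiff p).natAbs.gcd b : ℝ) ≤ 2 * D ^ 2 * N ^ 2 := by
    intro b hb
    calc _ ≤ ∑ k ∈ Finset.Icc 1 (N ^ 2), (2 * (k.divisors.card : ℝ)) * (k.gcd b : ℝ) :=
          sum_natAbs_sqDiff_le N (fun k => (k.gcd b : ℝ)) (fun _ => by positivity)
      _ ≤ ∑ k ∈ Finset.Icc 1 (N ^ 2), (2 * D) * (k.gcd b : ℝ) := by
          gcongr with k hk; exact hD k hk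
      _ = (2 * D) * ((∑ k ∈ Finset.Icc 1 (N ^ 2), k.gcd b : ℕ) : ℝ) := by
          rw [← Finset.mul_sum]; push_cast; rfl
      _ ≤ (2 * D) * ((N ^ 2 * b.divisors.card : ℕ) : ℝ) := by
          gcongr
          exact sum_gcd_le_mul_card_divisors _ _ (by rw [Finset.mem_Icc] at hb; omega)
      _ ≤ (2 * D) * (N ^ 2 * D) := by push_cast; gcongr; exact hD b hb
      _ = _ := by ring
  rw [Finset.sum_comm]
  calc _ = ∑ q ∈ distinctPairs N, (∑ p ∈ distinctPairs N,
        ((sqDiff p).natAbs.gcd (sqDiff q).natAbs : ℝ)) * ((sqDiff q).natAbs : ℝ)⁻¹ := by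
        simp_rw [Finset.sum_mul, div_eq_mul_inv]
    _ ≤ ∑ q ∈ distinctPairs N, (2 * D ^ 2 * N ^ 2) * ((sqDiff q).natAbs : ℝ)⁻¹ := by
        gcongr with q hq; exact inner _ (natAbs_sqDiff_mem hq)
    _ = (2 * D ^ 2 * N ^ 2) * ∑ q ∈ distinctPairs N, ((sqDiff q).natAbs : ℝ)⁻¹ := by
        rw [Finset.mul_sum]
    _ ≤ (2 * D ^ 2 * N ^ 2) * ∑ k ∈ Finset.Icc 1 (N ^ 2), (2 * D) * (k : ℝ)⁻¹ := by
        gcongr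
        refine (sum_natAbs_sqDiff_le N (fun k => (k : ℝ)⁻¹) (fun _ => by positivity)).trans ?_
        gcongr with k hk; exact hD k hk
    _ = (2 * D ^ 2 * N ^ 2) * ((2 * D) * ((harmonic (N ^ 2) : ℚ) : ℝ)) := by
        rw [← Finset.mul_sum, harmonic_eq_sum_Icc]; push_cast; rfl
    _ ≤ (2 * D ^ 2 * N ^ 2) * ((2 * D) * (1 + Real.log (N ^ 2 : ℕ))) := by
        gcongr; exact harmonic_le_one_add_log _
    _ = _ := by ring

theorem UnitAddCircle.coe_intCast (k : ℤ) : ((k : ℝ) : UnitAddCircle) = 0 :=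
  (AddCircle.coe_eq_zero_iff 1).2 ⟨k, by simp⟩

theorem UnitAddCircle.norm_coe_le_iff (x δ : ℝ) :
    ‖(x : UnitAddCircle)‖ ≤ δ ↔ ∃ k : ℤ, |x + k| ≤ δ := by
  rw [UnitAddCircle.norm_eq]
  constructor
  · exact fun h => ⟨-round x, by simpa [sub_eq_add_neg] using h⟩
  · rintro ⟨k, hk⟩
    refine (round_le x (-k)).trans ?_
    simpa using hk

theorem abs_card_Icc_ceil_floor_sub_le (u v : ℝ) (h : u ≤ v) :
    |((Finset.Icc ⌈u⌉ ⌊v⌋).card : ℝ) - (v - u)| ≤ 1 := by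
  have h1 := Int.lt_floor_add_one v
  have h2 := Int.ceil_lt_add_one u
  have h3 := Int.floor_le v
  have h4 := Int.le_ceil u
  have h5 : (0 : ℤ) ≤ ⌊v⌋ + 1 - ⌈u⌉ := by
    have : (-1 : ℝ) < ((⌊v⌋ + 1 - ⌈u⌉ : ℤ) : ℝ) := by push_cast; linarith
    have : (-1 : ℤ) < ⌊v⌋ + 1 - ⌈u⌉ := by exact_mod_cast this
    omega
  have h6 : ((Finset.Icc ⌈u⌉ ⌊v⌋).card : ℝ) = ⌊v⌋ + 1 - ⌈u⌉ := by
    rw [Int.card_Icc]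
    have : (((⌊v⌋ + 1 - ⌈u⌉).toNat : ℤ) : ℝ) = ((⌊v⌋ + 1 - ⌈u⌉ : ℤ) : ℝ) := by
      rw [Int.toNat_of_nonneg h5]
    push_cast at this ⊢
    exact this
  rw [h6, abs_le]
  constructor <;> linarith

/-- Among the `n` translates of a point by multiples of `1 / n`, the number of those at distance at
most `δ` from `0` differs from `2 * δ * n` by at most one. -/
theorem abs_card_filter_norm_le_sub_le (y : ℝ) (n : ℕ) (hn : 0 < n) (δ : ℝ) (hδ0 : 0 ≤ δ)
    (hδ : δ < 1 / 2) :
    |(((Finset.range n).filter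
      fun j : ℕ => ‖((y + j / n : ℝ) : UnitAddCircle)‖ ≤ δ).card : ℝ) - 2 * δ * n| ≤ 1 := by
  have hn' : (0 : ℝ) < n := by exact_mod_cast hn
  have hnz : (0 : ℤ) < n := by exact_mod_cast hn
  have hmem : ∀ l : ℤ, l ∈ Finset.Icc ⌈n * (-δ - y)⌉ ⌊n * (δ - y)⌋ ↔ |y + l / n| ≤ δ := by
    intro l
    rw [Finset.mem_Icc, Int.ceil_le, Int.le_floor, abs_le]
    have e : (l : ℝ) = n * (l / n) := by field_simp
    rw [e, mul_le_mul_iff_right₀ hn', mul_le_mul_iff_right₀ hn', ← e]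
    constructor <;> rintro ⟨h1, h2⟩ <;> constructor <;> linarith
  have hcard : (Finset.Icc ⌈n * (-δ - y)⌉ ⌊n * (δ - y)⌋).card = ((Finset.range n).filter
      fun j : ℕ => ‖((y + j / n : ℝ) : UnitAddCircle)‖ ≤ δ).card := by
    refine Finset.card_bij (fun l _ => (l % n).toNat) ?_ ?_ ?_
    · intro l hl
      rw [hmem] at hl
      have h0 := Int.emod_nonneg l hnz.ne'
      have h1 := Int.emod_lt_of_pos l hnz
      rw [Finset.mem_filter, Finset.mem_range, UnitAddCircle.norm_coe_le_iff]
      refine ⟨by omega, l / n, ?_⟩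
      have e : (((l % n).toNat : ℕ) : ℝ) = (l : ℝ) - n * (l / n : ℤ) := by
        have : (((l % n).toNat : ℕ) : ℤ) = l - n * (l / n) := by
          rw [Int.toNat_of_nonneg h0, Int.emod_def]
        exact_mod_cast congrArg (Int.cast : ℤ → ℝ) this
      rw [e]
      convert hl using 2
      field_simp
      ring
    · intro l hl l' hl' h
      rw [hmem] at hl hl'
      have h0 := Int.emod_nonneg l hnz.ne'
      have h0' := Int.emod_nonneg l' hnz.ne'
      have h1 : l % n = l' % n := by omega
      have h2 : (n : ℤ) ∣ l - l' := Int.ModEq.dvd h1.symm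
      obtain ⟨k, hk⟩ := h2
      have hk' : (l : ℝ) - l' = n * k := by exact_mod_cast congrArg (Int.cast : ℤ → ℝ) hk
      have h3 : (k : ℝ) = (y + l / n) - (y + l' / n) := by
        field_simp; linarith
      have h4 : |(k : ℝ)| < 1 := by
        rw [h3]
        exact (abs_sub _ _).trans_lt (by linarith)
      have h5 : k = 0 := by
        have : |k| < 1 := by exact_mod_cast h4
        exact Int.abs_lt_one_iff.1 this
      rw [h5] at hk
      omega
    · intro j hj
      rw [Finset.mem_filter, Finset.mem_range, UnitAddCircle.norm_coe_le_iff] at hj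
      obtain ⟨hj1, k, hk⟩ := hj
      refine ⟨j + n * k, ?_, ?_⟩
      · rw [hmem]
        convert hk using 2
        push_cast
        field_simp
        ring
      · rw [Int.add_mul_emod_self_left, Int.emod_eq_of_lt (by omega) (by omega), Int.toNat_natCast]
  rw [← hcard]
  have := abs_card_Icc_ceil_floor_sub_le (n * (-δ - y)) (n * (δ - y)) (by gcongr; linarith)
  convert this using 2
  ring

/-- The indicator function of the arc of radius `δ` around `0`. -/
noncomputable def arc (δ : ℝ) : UnitAddCircle → ℝ :=
  (Metric.closedBall (0 : UnitAddCircle) δ).indicator 1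

open Classical in
theorem arc_apply (δ : ℝ) (x : UnitAddCircle) : arc δ x = if ‖x‖ ≤ δ then 1 else 0 := by
  simp [arc, Set.indicator_apply]

theorem measurable_arc (δ : ℝ) : Measurable (arc δ) :=
  measurable_one.indicator Metric.isClosed_closedBall.measurableSet

theorem arc_nonneg (δ : ℝ) (x : UnitAddCircle) : 0 ≤ arc δ x :=
  Set.indicator_nonneg (fun _ _ => zero_le_one) x

theorem arc_le_one (δ : ℝ) (x : UnitAddCircle) : arc δ x ≤ 1 :=
  Set.indicator_le_self' (fun _ _ => zero_le_one) x

theorem measurable_arc_zsmul (δ : ℝ) (m : ℤ) : Measurable fun x => arc δ (m • x) :=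
  (measurable_arc δ).comp (measurable_const_smul m)

theorem integrable_arc_zsmul (δ : ℝ) (m : ℤ) : Integrable fun x => arc δ (m • x) :=
  Integrable.of_bound (measurable_arc_zsmul δ m).aestronglyMeasurable 1
    (ae_of_all _ fun x => by rw [Real.norm_of_nonneg (arc_nonneg _ _)]; exact arc_le_one _ _)

theorem integrable_arc_zsmul_add_mul (δ : ℝ) (a b : ℤ) (t : UnitAddCircle) :
    Integrable fun x => arc δ (a • x + t) * arc δ (b • x) :=
  Integrable.of_bound ((((measurable_arc δ).comp
      ((measurable_const_smul a).add_const t)).mul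
      (measurable_arc_zsmul δ b)).aestronglyMeasurable) 1
    (ae_of_all _ fun x => by
      rw [Real.norm_of_nonneg (mul_nonneg (arc_nonneg _ _) (arc_nonneg _ _))]
      exact mul_le_one₀ (arc_le_one _ _) (arc_nonneg _ _) (arc_le_one _ _))

theorem integrable_arc_zsmul_mul (δ : ℝ) (a b : ℤ) :
    Integrable fun x => arc δ (a • x) * arc δ (b • x) := by
  simpa using integrable_arc_zsmul_add_mul δ a b 0

theorem integral_arc_zsmul (δ : ℝ) (hδ0 : 0 ≤ δ) (hδ : δ < 1 / 2) (m : ℤ) (hm : m ≠ 0) :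
    ∫ x, arc δ (m • x) = 2 * δ := by
  have h1 : MeasurePreserving (fun x : UnitAddCircle => m • x) volume volume :=
    Measure.measurePreserving_zsmul volume hm
  have h2 : ∫ x, arc δ (m • x) = ∫ x, arc δ x := by
    conv_rhs => rw [← h1.map_eq]
    rw [integral_map h1.measurable.aemeasurable (measurable_arc δ).aestronglyMeasurable]
  rw [h2, arc, integral_indicator_one Metric.isClosed_closedBall.measurableSet, Measure.real,
    AddCircle.volume_closedBall, min_eq_right (by linarith),
    ENNReal.toReal_ofReal (by linarith)]

/-- The events that `a • x` and that `b • x` lie in a given arc are almost independent. -/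
theorem abs_integral_arc_mul_arc_sub_le (δ : ℝ) (hδ0 : 0 ≤ δ) (hδ : δ < 1 / 2) (a b : ℤ)
    (hb : b ≠ 0) :
    |(∫ x, arc δ (a • x) * arc δ (b • x)) - (2 * δ) ^ 2| ≤
      2 * δ * ((a.natAbs.gcd b.natAbs : ℝ) / b.natAbs) := by
  set n : ℕ := b.natAbs with hn
  set g : ℕ := a.natAbs.gcd n with hg
  have hn0 : 0 < n := Int.natAbs_pos.2 hb
  have hg0 : 0 < g := Nat.gcd_pos_of_pos_right _ hn0
  obtain ⟨n', hn'⟩ : g ∣ n := Nat.gcd_dvd_right _ _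
  have hn'0 : 0 < n' := by
    rcases Nat.eq_zero_or_pos n' with h | h
    · rw [h] at hn'; omega
    · exact h
  have hgR : (0 : ℝ) < g := by exact_mod_cast hg0
  have hnR : (0 : ℝ) < n := by exact_mod_cast hn0
  have hn'R : (0 : ℝ) < n' := by exact_mod_cast hn'0
  have hnn : (n : ℝ) = g * n' := by exact_mod_cast hn'
  obtain ⟨c, d, hcd⟩ : ∃ c d : ℤ, (g : ℤ) = a * c + n * d := by
    refine ⟨Int.gcdA a n, Int.gcdB a n, ?_⟩
    rw [← Int.gcd_eq_gcd_ab]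
    simp [Int.gcd, hg]
  have hcdR : (g : ℝ) = a * c + n * d := by exact_mod_cast congrArg (Int.cast : ℤ → ℝ) hcd
  have hshift : ∀ j : ℕ, ∃ t : UnitAddCircle,
      a • t = (((j : ℝ) / n' : ℝ) : UnitAddCircle) ∧ b • t = 0 := by
    intro j
    refine ⟨((c * j / n : ℝ) : UnitAddCircle), ?_, ?_⟩
    · have e : a • (c * j / n : ℝ) = (j : ℝ) / n' + ((-(d * j) : ℤ) : ℝ) := by
        rw [zsmul_eq_mul]
        push_cast
        have : (j : ℝ) / n' = g * j / n := by rw [hnn]; field_simp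
        rw [this, hcdR]
        field_simp
        ring
      rw [← AddCircle.coe_zsmul, e, AddCircle.coe_add, UnitAddCircle.coe_intCast, add_zero]
    · rw [← AddCircle.coe_zsmul, zsmul_eq_mul]
      rcases Int.natAbs_eq b with h | h
      · have e : (b : ℝ) * (c * j / n) = ((c * j : ℤ) : ℝ) := by
          rw [h, ← hn]; push_cast; field_simp
        rw [e, UnitAddCircle.coe_intCast]
      · have e : (b : ℝ) * (c * j / n) = ((-(c * j) : ℤ) : ℝ) := by
          rw [h, ← hn]; push_cast; field_simp
        rw [e, UnitAddCircle.coe_intCast]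
  have hint : ∀ j : ℕ, ∫ x, arc δ (a • x + (((j : ℝ) / n' : ℝ) : UnitAddCircle)) * arc δ (b • x) =
      ∫ x, arc δ (a • x) * arc δ (b • x) := by
    intro j
    obtain ⟨t, ht1, ht2⟩ := hshift j
    rw [← integral_add_right_eq_self (fun x => arc δ (a • x) * arc δ (b • x)) t]
    simp_rw [smul_add, ht1, ht2, add_zero]
  set I := ∫ x, arc δ (a • x) * arc δ (b • x) with hI
  set S : UnitAddCircle → ℝ := fun x =>
    ∑ j ∈ Finset.range n', arc δ (a • x + (((j : ℝ) / n' : ℝ) : UnitAddCircle)) with hS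
  have hSle : ∀ x, |S x - 2 * δ * n'| ≤ 1 := by
    intro x
    obtain ⟨y, hy⟩ := QuotientAddGroup.mk_surjective (a • x)
    have hy' : (y : UnitAddCircle) = a • x := hy
    have := abs_card_filter_norm_le_sub_le y n' hn'0 δ hδ0 hδ
    simp only [hS, ← hy', ← AddCircle.coe_add]
    simp only [arc_apply, Finset.sum_boole]
    convert this
  have hSint : ∫ x, S x * arc δ (b • x) = n' * I := by
    simp only [hS, Finset.sum_mul]
    rw [integral_finsetSum _ fun j _ => integrable_arc_zsmul_add_mul δ a b _]
    simp [hint]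
  have hSi : Integrable fun x => S x * arc δ (b • x) := by
    simp only [hS, Finset.sum_mul]
    exact integrable_finsetSum _ fun j _ => integrable_arc_zsmul_add_mul δ a b _
  have hA := integral_arc_zsmul δ hδ0 hδ b hb
  have hbi := integrable_arc_zsmul δ b
  have up : n' * I ≤ (2 * δ * n' + 1) * (2 * δ) := by
    rw [← hSint, ← hA, ← integral_const_mul]
    refine integral_mono hSi (hbi.const_mul _) fun x => ?_
    rw [hA]
    exact mul_le_mul_of_nonneg_right (by linarith [(abs_le.1 (hSle x)).2]) (arc_nonneg _ _)
  have lo : (2 * δ * n' - 1) * (2 * δ) ≤ n' * I := by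
    rw [← hSint, ← hA, ← integral_const_mul]
    refine integral_mono (hbi.const_mul _) hSi fun x => ?_
    rw [hA]
    exact mul_le_mul_of_nonneg_right (by linarith [(abs_le.1 (hSle x)).1]) (arc_nonneg _ _)
  have hgn : (g : ℝ) / n = 1 / n' := by rw [hnn]; field_simp
  rw [hgn, abs_le]
  constructor
  · rw [← mul_le_mul_iff_right₀ hn'R]
    have : (n' : ℝ) * -(2 * δ * (1 / n')) = - (2 * δ) := by field_simp
    rw [this]; nlinarith
  · rw [← mul_le_mul_iff_right₀ hn'R]
    have : (n' : ℝ) * (2 * δ * (1 / n')) = 2 * δ := by field_simp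
    rw [this]; nlinarith

theorem integral_sq_sum_arc_sub_le {ι : Type*} (P : Finset ι) (m : ι → ℤ)
    (hm : ∀ p ∈ P, m p ≠ 0) (δ : ℝ) (hδ0 : 0 ≤ δ) (hδ : δ < 1 / 2) :
    ∫ x : UnitAddCircle, ((∑ p ∈ P, arc δ (m p • x)) - 2 * δ * P.card) ^ 2 ≤
      2 * δ * ∑ p ∈ P, ∑ q ∈ P, ((m p).natAbs.gcd (m q).natAbs : ℝ) / (m q).natAbs := by
  have e : ∀ x : UnitAddCircle, ((∑ p ∈ P, arc δ (m p • x)) - 2 * δ * P.card) ^ 2 =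
      ∑ p ∈ P, ∑ q ∈ P, (arc δ (m p • x) * arc δ (m q • x) - 2 * δ * arc δ (m p • x)
        - 2 * δ * arc δ (m q • x) + (2 * δ) ^ 2) := by
    intro x
    have : (∑ p ∈ P, arc δ (m p • x)) - 2 * δ * P.card =
        ∑ p ∈ P, (arc δ (m p • x) - 2 * δ) := by
      rw [Finset.sum_sub_distrib, Finset.sum_const, nsmul_eq_mul]; ring
    rw [this, sq, Finset.sum_mul_sum]
    refine Finset.sum_congr rfl fun p _ => Finset.sum_congr rfl fun q _ => ?_
    ring
  have hi : ∀ p q, Integrable fun x : UnitAddCircle =>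
      (arc δ (m p • x) * arc δ (m q • x) - 2 * δ * arc δ (m p • x)
        - 2 * δ * arc δ (m q • x) + (2 * δ) ^ 2) := fun p q =>
    (((integrable_arc_zsmul_mul δ _ _).sub ((integrable_arc_zsmul δ _).const_mul _)).sub
      ((integrable_arc_zsmul δ _).const_mul _)).add (integrable_const _)
  simp_rw [e]
  rw [integral_finsetSum _ fun p _ => integrable_finsetSum _ fun q _ => hi p q, Finset.mul_sum]
  refine Finset.sum_le_sum fun p hp => ?_
  rw [integral_finsetSum _ fun q _ => hi p q, Finset.mul_sum]
  refine Finset.sum_le_sum fun q hq => ?_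
  refine le_trans (le_of_eq ?_)
    ((le_abs_self _).trans (abs_integral_arc_mul_arc_sub_le δ hδ0 hδ (m p) (m q) (hm q hq)))
  have h1 := integrable_arc_zsmul_mul δ (m p) (m q)
  have h2 := (integrable_arc_zsmul δ (m p)).const_mul (2 * δ)
  have h3 := (integrable_arc_zsmul δ (m q)).const_mul (2 * δ)
  have h4 : Integrable fun x => arc δ (m p • x) * arc δ (m q • x) - 2 * δ * arc δ (m p • x) :=
    h1.sub h2
  have h5 : Integrable fun x => arc δ (m p • x) * arc δ (m q • x) - 2 * δ * arc δ (m p • x)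
      - 2 * δ * arc δ (m q • x) := h4.sub h3
  rw [integral_add h5 (integrable_const _), integral_sub h4 h3, integral_sub h1 h2,
    integral_const_mul, integral_const_mul, integral_arc_zsmul δ hδ0 hδ _ (hm p hp),
    integral_arc_zsmul δ hδ0 hδ _ (hm q hq), integral_const, measureReal_def, UnitAddCircle.measure_univ]
  simp
  ring

/-- The number of pairs of distinct `x, y ≤ N` for which `(x ^ 2 - y ^ 2) • t` lies within `δ`
of `0`. -/
noncomputable def closePairs (N : ℕ) (δ : ℝ) (t : UnitAddCircle) : ℝ :=
  ∑ p ∈ distinctPairs N, arc δ (sqDiff p • t)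

theorem closePairs_nonneg (N : ℕ) (δ : ℝ) (t : UnitAddCircle) : 0 ≤ closePairs N δ t :=
  Finset.sum_nonneg fun _ _ => arc_nonneg _ _

theorem closePairs_mono {N N' : ℕ} {δ δ' : ℝ} (hN : N ≤ N') (hδ : δ ≤ δ') (t : UnitAddCircle) :
    closePairs N δ t ≤ closePairs N' δ' t := by
  have hsub : distinctPairs N ⊆ distinctPairs N' := by
    intro p hp
    simp only [distinctPairs, Finset.mem_filter, Finset.mem_product, Finset.mem_Icc] at hp ⊢
    omega
  calc closePairs N δ t ≤ ∑ p ∈ distinctPairs N, arc δ' (sqDiff p • t) :=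
        Finset.sum_le_sum fun p _ => Set.indicator_le_indicator_of_subset
          (Metric.closedBall_subset_closedBall hδ) (fun _ => zero_le_one) _
    _ ≤ _ := Finset.sum_le_sum_of_subset_of_nonneg hsub fun _ _ _ => arc_nonneg _ _

theorem closePairs_le (N : ℕ) (δ : ℝ) (t : UnitAddCircle) : closePairs N δ t ≤ (N : ℝ) ^ 2 := by
  have h : closePairs N δ t ≤ ∑ _p ∈ distinctPairs N, (1 : ℝ) :=
    Finset.sum_le_sum fun _ _ => arc_le_one _ _
  rw [Finset.sum_const, nsmul_eq_mul, mul_one, card_distinctPairs] at h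
  linarith [Nat.cast_nonneg (α := ℝ) N]

theorem exists_integral_sq_closePairs_sub_le :
    ∃ K : ℝ, 0 < K ∧ ∀ j : ℕ, 1 ≤ j → ∀ δ : ℝ, 0 ≤ δ → δ < 1 / 2 →
      ∫ t, (closePairs (j ^ 16) δ t - 2 * δ * (distinctPairs (j ^ 16)).card) ^ 2 ≤
        K * δ * (j : ℝ) ^ 39 := by
  obtain ⟨C, hC0, hC⟩ := exists_card_divisors_pow_le 16 (by norm_num)
  have hC0R : (0 : ℝ) < C := by exact_mod_cast hC0
  refine ⟨264 * (C : ℝ) ^ 3, by positivity, fun j hj δ hδ0 hδ => ?_⟩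
  have hj' : (1 : ℝ) ≤ j := by exact_mod_cast hj
  have hD : ∀ k ∈ Finset.Icc 1 ((j ^ 16) ^ 2), (k.divisors.card : ℝ) ≤ C * (j : ℝ) ^ 2 := by
    intro k hk
    rw [Finset.mem_Icc] at hk
    have h : k.divisors.card ^ 16 ≤ (C * j ^ 2) ^ 16 := by
      calc k.divisors.card ^ 16 ≤ C * k := hC k (by omega)
        _ ≤ C ^ 16 * (j ^ 16) ^ 2 :=
            Nat.mul_le_mul (Nat.le_self_pow (by norm_num) C) hk.2
        _ = _ := by ring
    exact_mod_cast (Nat.pow_le_pow_iff_left (by norm_num)).1 h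
  have hlog : 1 + Real.log (((j ^ 16) ^ 2 : ℕ) : ℝ) ≤ 33 * j := by
    have h1 : (((j ^ 16) ^ 2 : ℕ) : ℝ) = (j : ℝ) ^ 32 := by push_cast; ring
    rw [h1, Real.log_pow]
    have := Real.log_le_sub_one_of_pos (show (0 : ℝ) < j by linarith)
    push_cast
    linarith
  refine (integral_sq_sum_arc_sub_le (distinctPairs (j ^ 16)) sqDiff
    (fun p hp => sqDiff_ne_zero hp) δ hδ0 hδ).trans ?_
  calc _ ≤ 2 * δ * (4 * (C * (j : ℝ) ^ 2) ^ 3 * ((j ^ 16 : ℕ) : ℝ) ^ 2 *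
        (1 + Real.log (((j ^ 16) ^ 2 : ℕ) : ℝ))) := by
        gcongr; exact sum_gcd_div_le _ _ hD
    _ ≤ 2 * δ * (4 * (C * (j : ℝ) ^ 2) ^ 3 * ((j ^ 16 : ℕ) : ℝ) ^ 2 * (33 * j)) := by gcongr
    _ = _ := by push_cast; ring

theorem integrable_sq_closePairs_sub (N : ℕ) (δ c : ℝ) :
    Integrable fun t => (closePairs N δ t - c) ^ 2 := by
  have hm : Measurable fun t => closePairs N δ t :=
    Finset.measurable_sum _ fun p _ => measurable_arc_zsmul δ (sqDiff p)
  refine Integrable.of_bound ((hm.sub_const c).pow_const 2).aestronglyMeasurable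
    (((N : ℝ) ^ 2 + |c|) ^ 2) (ae_of_all _ fun t => ?_)
  rw [Real.norm_of_nonneg (sq_nonneg _), ← sq_abs]
  gcongr
  refine (abs_sub _ _).trans ?_
  rw [abs_of_nonneg (closePairs_nonneg _ _ _)]
  gcongr
  exact closePairs_le _ _ _

/-- The points at which `closePairs` is far from its mean for `N = j ^ 16`, `δ = i / j ^ 18`. -/
def atypical (j i : ℕ) : Set UnitAddCircle :=
  {t | ((j : ℝ) ^ 31 * (i / (j : ℝ) ^ 18)) ^ 2 ≤
    (closePairs (j ^ 16) (i / (j : ℝ) ^ 18) t -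
      2 * (i / (j : ℝ) ^ 18) * (distinctPairs (j ^ 16)).card) ^ 2}

theorem exists_volume_iUnion_atypical_le :
    ∃ K : ℝ, 0 < K ∧ ∀ j : ℕ,
      volume (⋃ i ∈ (Finset.Icc 1 (j ^ 18)).filter (fun i => 2 * i < j ^ 18), atypical j i) ≤
        ENNReal.ofReal (K * (1 / (j : ℝ) ^ 4)) := by
  obtain ⟨K, hK, h⟩ := exists_integral_sq_closePairs_sub_le
  refine ⟨19 * K, by positivity, fun j => ?_⟩
  rcases Nat.eq_zero_or_pos j with rfl | hj
  · simp
  have hj' : (1 : ℝ) ≤ j := by exact_mod_cast hj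
  have hj0 : (0 : ℝ) < j := by linarith
  have hone : ∀ i ∈ (Finset.Icc 1 (j ^ 18)).filter (fun i => 2 * i < j ^ 18),
      volume (atypical j i) ≤ ENNReal.ofReal (K / (j : ℝ) ^ 5 * (i : ℝ)⁻¹) := by
    intro i hi
    simp only [Finset.mem_filter, Finset.mem_Icc] at hi
    have hi0 : (0 : ℝ) < i := by exact_mod_cast hi.1.1
    have hi2 : (2 : ℝ) * i < (j : ℝ) ^ 18 := by exact_mod_cast hi.2
    set δ : ℝ := i / (j : ℝ) ^ 18 with hδ
    have hδ0 : 0 < δ := by positivity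
    have hδ2 : δ < 1 / 2 := by rw [hδ, div_lt_iff₀ (by positivity)]; linarith
    have hcheb := (mul_meas_ge_le_integral_of_nonneg
      (ae_of_all _ fun t => sq_nonneg _) (integrable_sq_closePairs_sub (j ^ 16) δ
        (2 * δ * (distinctPairs (j ^ 16)).card)) (((j : ℝ) ^ 31 * δ) ^ 2)).trans
      (h j hj δ hδ0.le hδ2)
    rw [← ofReal_measureReal (measure_ne_top _ _)]
    apply ENNReal.ofReal_le_ofReal
    have hpos : 0 < ((j : ℝ) ^ 31 * δ) ^ 2 := by positivity
    rw [← mul_le_mul_iff_right₀ hpos]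
    refine hcheb.trans (le_of_eq ?_)
    rw [hδ]
    field_simp
  calc _ ≤ ∑ i ∈ (Finset.Icc 1 (j ^ 18)).filter (fun i => 2 * i < j ^ 18),
        volume (atypical j i) := measure_biUnion_finset_le _ _
    _ ≤ ∑ i ∈ (Finset.Icc 1 (j ^ 18)).filter (fun i => 2 * i < j ^ 18),
        ENNReal.ofReal (K / (j : ℝ) ^ 5 * (i : ℝ)⁻¹) := Finset.sum_le_sum hone
    _ ≤ ∑ i ∈ Finset.Icc 1 (j ^ 18), ENNReal.ofReal (K / (j : ℝ) ^ 5 * (i : ℝ)⁻¹) :=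
        Finset.sum_le_sum_of_subset (Finset.filter_subset _ _)
    _ = ENNReal.ofReal (∑ i ∈ Finset.Icc 1 (j ^ 18), K / (j : ℝ) ^ 5 * (i : ℝ)⁻¹) := by
        rw [ENNReal.ofReal_sum_of_nonneg fun i _ => by positivity]
    _ ≤ _ := by
        apply ENNReal.ofReal_le_ofReal
        rw [← Finset.mul_sum]
        have hh : ∑ i ∈ Finset.Icc 1 (j ^ 18), (i : ℝ)⁻¹ = ((harmonic (j ^ 18) : ℚ) : ℝ) := by
          rw [harmonic_eq_sum_Icc]; push_cast; rfl
        have hle := harmonic_le_one_add_log (j ^ 18)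
        have hlog := Real.log_le_sub_one_of_pos hj0
        push_cast at hle
        rw [Real.log_pow] at hle
        push_cast at hle
        rw [hh]
        calc _ ≤ K / (j : ℝ) ^ 5 * (19 * j) := by gcongr; linarith
          _ = _ := by field_simp

theorem ae_eventually_abs_closePairs_sub_le :
    ∀ᵐ t : UnitAddCircle, ∃ J : ℕ, ∀ j : ℕ, J ≤ j → ∀ i : ℕ, 1 ≤ i → 2 * i < j ^ 18 →
      |closePairs (j ^ 16) (i / (j : ℝ) ^ 18) t - 2 * (i / (j : ℝ) ^ 18) * (j : ℝ) ^ 32| ≤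
        3 * (j : ℝ) ^ 31 * (i / (j : ℝ) ^ 18) := by
  obtain ⟨K, hK, h⟩ := exists_volume_iUnion_atypical_le
  have hsum : Summable fun j : ℕ => K * (1 / (j : ℝ) ^ 4) :=
    (Real.summable_one_div_nat_pow.2 (by norm_num)).mul_left K
  have hfin := ne_top_of_le_ne_top hsum.tsum_ofReal_ne_top (ENNReal.tsum_le_tsum h)
  filter_upwards [ae_eventually_notMem hfin] with t ht
  obtain ⟨J, hJ⟩ := Filter.eventually_atTop.1 ht
  refine ⟨J + 1, fun j hj i hi hij => ?_⟩
  have hn := hJ j (by omega)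
  simp only [Set.mem_iUnion, Finset.mem_filter, Finset.mem_Icc, not_exists] at hn
  have hn' := hn i ⟨⟨hi, by omega⟩, hij⟩
  have hj0 : (1 : ℝ) ≤ j := by exact_mod_cast (by omega : 1 ≤ j)
  have hi0 : (0 : ℝ) < i := by exact_mod_cast hi
  simp only [atypical, Set.mem_ofPred_eq, not_le] at hn'
  set δ : ℝ := i / (j : ℝ) ^ 18 with hδ
  have hδ0 : 0 < δ := by positivity
  have h1 := abs_lt_of_sq_lt_sq hn' (by positivity)
  rw [card_distinctPairs] at h1
  push_cast at h1
  have h2 : (j : ℝ) ^ 16 ≤ (j : ℝ) ^ 31 := pow_le_pow_right₀ hj0 (by norm_num)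
  have h3 : δ * (j : ℝ) ^ 16 ≤ δ * (j : ℝ) ^ 31 := by gcongr
  have h4 : 0 ≤ δ * (j : ℝ) ^ 16 := by positivity
  have h5 : ((j : ℝ) ^ 16) ^ 2 = (j : ℝ) ^ 32 := by ring
  rw [h5] at h1
  rw [abs_lt] at h1
  rw [abs_le]
  constructor <;> nlinarith

theorem one_add_pow_le_one_add_two_pow_sub_one_mul (n : ℕ) (u : ℝ) (hu0 : 0 ≤ u) (hu1 : u ≤ 1) :
    (1 + u) ^ n ≤ 1 + (2 ^ n - 1) * u := by
  induction n with
  | zero => simp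
  | succ n ih =>
    have h2 : (0 : ℝ) ≤ 2 ^ n - 1 := sub_nonneg.2 (one_le_pow₀ (by norm_num))
    calc (1 + u) ^ (n + 1) ≤ (1 + (2 ^ n - 1) * u) * (1 + u) := by rw [pow_succ]; gcongr
      _ ≤ 1 + (2 ^ (n + 1) - 1) * u := by
        rw [pow_succ]
        nlinarith [mul_nonneg h2 (mul_nonneg hu0 (sub_nonneg.2 hu1))]

theorem exists_pow_le_lt_succ_pow (k : ℕ) (hk : k ≠ 0) (N : ℕ) :
    ∃ j : ℕ, j ^ k ≤ N ∧ N < (j + 1) ^ k :=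
  ⟨Nat.nthRoot k N, Nat.pow_nthRoot_le (Or.inl hk), Nat.lt_pow_nthRoot_add_one hk N⟩

theorem upper_perturbation {u δ δ' M Y : ℝ} (hu0 : 0 < u) (hu1 : u ≤ 1) (hδ0 : 0 < δ)
    (hδ' : δ' ≤ δ * (1 + 16 * u)) (hM : 0 ≤ M) (hY0 : 0 ≤ Y)
    (hY : Y ≤ M * (1 + (2 ^ 32 - 1) * u)) :
    2 * δ' * Y + 3 * (Y * u) * δ' ≤ M * δ * (2 + 2 ^ 40 * u) := by
  calc 2 * δ' * Y + 3 * (Y * u) * δ' = δ' * Y * (2 + 3 * u) := by ring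
    _ ≤ (δ * (1 + 16 * u)) * (M * (1 + (2 ^ 32 - 1) * u)) * (2 + 3 * u) := by gcongr
    _ = M * δ * ((1 + 16 * u) * (1 + (2 ^ 32 - 1) * u) * (2 + 3 * u)) := by ring
    _ ≤ _ := by
        gcongr
        have h2 : u ^ 2 ≤ u := by nlinarith
        have h3 : u ^ 3 ≤ u := by nlinarith
        norm_num
        nlinarith

theorem lower_perturbation {u δ δ' M Y : ℝ} (hu0 : 0 < u) (hu : 2 ^ 24 * u ≤ 1) (hδ0 : 0 < δ)
    (hδ' : δ * (1 - 2 ^ 20 * u) ≤ δ') (hM : 0 ≤ M) (hY0 : 0 ≤ Y)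
    (hY : M * (1 - (2 ^ 32 - 1) * u) ≤ Y) :
    M * δ * (2 - 2 ^ 40 * u) ≤ 2 * δ' * Y - 3 * (Y * u) * δ' := by
  have hu1 : u ≤ 1 := by linarith
  have h23 : 0 ≤ 2 - 3 * u := by linarith
  have hfac : 0 ≤ (1 - 2 ^ 20 * u) * (2 - 3 * u) := mul_nonneg (by linarith) h23
  calc _ ≤ M * δ * ((1 - (2 ^ 32 - 1) * u) * ((1 - 2 ^ 20 * u) * (2 - 3 * u))) := by
        refine mul_le_mul_of_nonneg_left ?_ (by positivity)
        have h2 : 0 ≤ u ^ 2 := by positivity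
        have h3 : u ^ 3 ≤ u ^ 2 := pow_le_pow_of_le_one hu0.le hu1 (by norm_num)
        have h4 : u ^ 2 * 2 ^ 24 ≤ u := by nlinarith
        norm_num at *
        nlinarith
    _ = (M * (1 - (2 ^ 32 - 1) * u)) * (δ * ((1 - 2 ^ 20 * u) * (2 - 3 * u))) := by ring
    _ ≤ Y * (δ * ((1 - 2 ^ 20 * u) * (2 - 3 * u))) := by gcongr
    _ = (δ * (1 - 2 ^ 20 * u)) * (Y * (2 - 3 * u)) := by ring
    _ ≤ δ' * (Y * (2 - 3 * u)) := by gcongr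
    _ = _ := by ring

theorem closePairs_le_of_grid (t : UnitAddCircle) (j N : ℕ) (δ : ℝ) (hj : 1 ≤ j)
    (hN : N < (j + 1) ^ 16) (hjN : j ^ 16 ≤ N) (hδ0 : 0 < δ) (hδ : δ ≤ 1 / 4)
    (hδN : 1 ≤ 16 * δ * (j + 1 : ℝ) ^ 16 * j)
    (h : ∀ i : ℕ, 1 ≤ i → 2 * i < (j + 1) ^ 18 →
      |closePairs ((j + 1) ^ 16) (i / (j + 1 : ℝ) ^ 18) t -
        2 * (i / (j + 1 : ℝ) ^ 18) * (j + 1 : ℝ) ^ 32| ≤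
        3 * (j + 1 : ℝ) ^ 31 * (i / (j + 1 : ℝ) ^ 18)) :
    closePairs N δ t ≤ (N : ℝ) ^ 2 * δ * (2 + 2 ^ 40 * (1 / j)) := by
  have hx1 : (1 : ℝ) ≤ j := by exact_mod_cast hj
  set x : ℝ := (j : ℝ) with hx
  set u : ℝ := 1 / x with hu
  have hu0 : 0 < u := by positivity
  have hu1 : u ≤ 1 := by rw [hu, div_le_one (by positivity)]; exact hx1
  have hxu : x * u = 1 := by rw [hu]; field_simp
  set i : ℕ := ⌊δ * (x + 1) ^ 18⌋₊ + 1 with hi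
  have hi1 : (i : ℝ) ≤ δ * (x + 1) ^ 18 + 1 := by
    rw [hi]; push_cast
    linarith [Nat.floor_le (show 0 ≤ δ * (x + 1) ^ 18 by positivity)]
  have hi2 : δ * (x + 1) ^ 18 ≤ i := by
    rw [hi]; push_cast
    exact (Nat.lt_floor_add_one _).le
  have hy18 : (2 : ℝ) ^ 18 ≤ (x + 1) ^ 18 := by gcongr; linarith
  have hi3 : 2 * i < (j + 1) ^ 18 := by
    have : 2 * (i : ℝ) < (x + 1) ^ 18 := by
      have : δ * (x + 1) ^ 18 ≤ 1 / 4 * (x + 1) ^ 18 := by gcongr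
      norm_num at hy18
      linarith
    rw [hx] at this
    exact_mod_cast this
  set δ' : ℝ := i / (x + 1) ^ 18 with hδ'
  have hx18 : 0 < (x + 1) ^ 18 := pow_pos (by linarith) _
  have hδ'0 : 0 ≤ δ' := div_nonneg (Nat.cast_nonneg _) hx18.le
  have hδδ' : δ ≤ δ' := by rw [hδ', le_div_iff₀ hx18]; exact hi2
  have hδ'le : δ' ≤ δ * (1 + 16 * u) := by
    rw [hδ', div_le_iff₀ hx18]
    have e : x ≤ (x + 1) ^ 2 * u := by
      calc x = x ^ 2 * u := by rw [sq, mul_assoc, hxu, mul_one]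
        _ ≤ _ := by gcongr; linarith
    have e2 : 16 * δ * (x + 1) ^ 16 * x ≤ 16 * δ * (x + 1) ^ 16 * ((x + 1) ^ 2 * u) := by gcongr
    calc (i : ℝ) ≤ δ * (x + 1) ^ 18 + 16 * δ * (x + 1) ^ 16 * ((x + 1) ^ 2 * u) := by linarith
      _ = _ := by ring
  have hb := (abs_le.1 (h i (by omega) hi3)).2
  have hy : (x + 1) ^ 32 ≤ (N : ℝ) ^ 2 * (1 + (2 ^ 32 - 1) * u) := by
    have e : x + 1 = x * (1 + u) := by rw [mul_add, hxu, mul_one]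
    have hxN : x ^ 16 ≤ N := by rw [hx]; exact_mod_cast hjN
    have hx32 : x ^ 32 ≤ (N : ℝ) ^ 2 := by
      calc x ^ 32 = (x ^ 16) ^ 2 := by ring
        _ ≤ _ := pow_le_pow_left₀ (pow_nonneg (by linarith) _) hxN 2
    rw [e, mul_pow]
    exact mul_le_mul hx32 (one_add_pow_le_one_add_two_pow_sub_one_mul 32 u hu0.le hu1)
      (pow_nonneg (by linarith) _) (sq_nonneg _)
  have h31 : (x + 1) ^ 31 ≤ (x + 1) ^ 32 * u := by
    have e : 1 ≤ (x + 1) * u := by rw [add_mul, hxu]; linarith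
    calc (x + 1) ^ 31 = (x + 1) ^ 31 * 1 := by ring
      _ ≤ (x + 1) ^ 31 * ((x + 1) * u) :=
        mul_le_mul_of_nonneg_left e (pow_nonneg (by linarith) _)
      _ = _ := by ring
  calc closePairs N δ t ≤ closePairs ((j + 1) ^ 16) δ' t := closePairs_mono hN.le hδδ' t
    _ ≤ 2 * δ' * (x + 1) ^ 32 + 3 * (x + 1) ^ 31 * δ' := by linarith
    _ ≤ 2 * δ' * (x + 1) ^ 32 + 3 * ((x + 1) ^ 32 * u) * δ' := by
        linarith [mul_le_mul_of_nonneg_right h31 hδ'0]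
    _ ≤ _ := upper_perturbation hu0 hu1 hδ0 hδ'le (sq_nonneg _)
        (pow_nonneg (by linarith) _) hy

theorem le_closePairs_of_grid (t : UnitAddCircle) (j N : ℕ) (δ : ℝ) (hj : 2 ^ 24 ≤ j)
    (hN : N < (j + 1) ^ 16) (hjN : j ^ 16 ≤ N) (hδ0 : 0 < δ) (hδ : δ ≤ 1 / 4)
    (hδN : 1 ≤ 16 * δ * (j + 1 : ℝ) ^ 16 * j)
    (h : ∀ i : ℕ, 1 ≤ i → 2 * i < j ^ 18 →
      |closePairs (j ^ 16) (i / (j : ℝ) ^ 18) t - 2 * (i / (j : ℝ) ^ 18) * (j : ℝ) ^ 32| ≤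
        3 * (j : ℝ) ^ 31 * (i / (j : ℝ) ^ 18)) :
    (N : ℝ) ^ 2 * δ * (2 - 2 ^ 40 * (1 / j)) ≤ closePairs N δ t := by
  have hx24 : (2 : ℝ) ^ 24 ≤ j := by exact_mod_cast hj
  have hNy : (N : ℝ) ≤ (j + 1 : ℝ) ^ 16 := by exact_mod_cast hN.le
  set x : ℝ := (j : ℝ) with hx
  have hx1 : 1 ≤ x := le_trans (by norm_num) hx24
  set u : ℝ := 1 / x with hu
  have hu0 : 0 < u := by positivity
  have hu24 : 2 ^ 24 * u ≤ 1 := by rw [hu, mul_one_div, div_le_one (by positivity)]; exact hx24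
  have hu1 : u ≤ 1 := by linarith
  have hxu : x * u = 1 := by rw [hu]; field_simp
  have h17 : 1 ≤ 2 ^ 20 * δ * x ^ 17 := by
    calc 1 ≤ 16 * δ * (x + 1) ^ 16 * x := hδN
      _ ≤ 16 * δ * (2 * x) ^ 16 * x := by gcongr; linarith
      _ = _ := by ring
  have h18 : 2 ^ 20 * δ * x ^ 17 = δ * x ^ 18 * (2 ^ 20 * u) := by
    calc 2 ^ 20 * δ * x ^ 17 = 2 ^ 20 * δ * x ^ 17 * (x * u) := by rw [hxu, mul_one]
      _ = _ := by ring
  have hbig : 1 ≤ δ * x ^ 18 := by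
    rw [h18] at h17
    refine h17.trans (mul_le_of_le_one_right (by positivity) (by linarith))
  set i : ℕ := ⌊δ * x ^ 18⌋₊ with hi
  have hi0 : 1 ≤ i := Nat.le_floor (by simpa using hbig)
  have hi1 : (i : ℝ) ≤ δ * x ^ 18 := Nat.floor_le (by positivity)
  have hi2 : δ * x ^ 18 - 1 ≤ i := by linarith [Nat.lt_floor_add_one (δ * x ^ 18)]
  have hi3 : 2 * i < j ^ 18 := by
    have : 2 * (i : ℝ) < x ^ 18 := by
      have : δ * x ^ 18 ≤ 1 / 4 * x ^ 18 := by gcongr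
      have : 0 < x ^ 18 := by positivity
      linarith
    rw [hx] at this
    exact_mod_cast this
  set δ' : ℝ := i / x ^ 18 with hδ'
  have hδδ' : δ' ≤ δ := by rw [hδ', div_le_iff₀ (by positivity)]; exact hi1
  have hδ'le : δ * (1 - 2 ^ 20 * u) ≤ δ' := by
    rw [hδ', le_div_iff₀ (by positivity)]
    linarith
  have hb := (abs_le.1 (h i hi0 hi3)).1
  have hy : (N : ℝ) ^ 2 * (1 - (2 ^ 32 - 1) * u) ≤ x ^ 32 := by
    have e : x + 1 = x * (1 + u) := by rw [mul_add, hxu, mul_one]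
    have h1 : (N : ℝ) ^ 2 ≤ x ^ 32 * (1 + (2 ^ 32 - 1) * u) := by
      calc (N : ℝ) ^ 2 ≤ ((x + 1) ^ 16) ^ 2 := by gcongr
        _ = x ^ 32 * (1 + u) ^ 32 := by rw [← pow_mul, e, mul_pow]
        _ ≤ _ := by
          gcongr
          exact one_add_pow_le_one_add_two_pow_sub_one_mul 32 u hu0.le hu1
    have hx32 : 0 < x ^ 32 := by positivity
    rcases le_or_gt (1 - (2 ^ 32 - 1) * u) 0 with hneg | hpos
    · exact (mul_nonpos_of_nonneg_of_nonpos (sq_nonneg _) hneg).trans hx32.le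
    · calc _ ≤ x ^ 32 * (1 + (2 ^ 32 - 1) * u) * (1 - (2 ^ 32 - 1) * u) := by gcongr
        _ = x ^ 32 * (1 - ((2 ^ 32 - 1) * u) ^ 2) := by ring
        _ ≤ x ^ 32 * 1 := by gcongr; linarith [sq_nonneg (((2 : ℝ) ^ 32 - 1) * u)]
        _ = _ := mul_one _
  have h31 : x ^ 31 = x ^ 32 * u := by
    calc x ^ 31 = x ^ 31 * (x * u) := by rw [hxu, mul_one]
      _ = _ := by ring
  calc _ ≤ 2 * δ' * x ^ 32 - 3 * (x ^ 32 * u) * δ' :=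
        lower_perturbation hu0 hu24 hδ0 hδ'le (sq_nonneg _) (pow_nonneg (by linarith) _) hy
    _ = 2 * δ' * x ^ 32 - 3 * x ^ 31 * δ' := by rw [h31]
    _ ≤ closePairs (j ^ 16) δ' t := by linarith
    _ ≤ _ := closePairs_mono hjN hδδ' t

theorem one_div_le_two_mul_rpow_neg {j N : ℕ} (hj : 1 ≤ j) (hN : (0 : ℝ) < N)
    (hNj : (N : ℝ) ≤ (j + 1 : ℝ) ^ 16) :
    1 / (j : ℝ) ≤ 2 * (N : ℝ) ^ (-(1 / 16) : ℝ) := by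
  have hj' : (1 : ℝ) ≤ j := by exact_mod_cast hj
  have h1 : (N : ℝ) ^ (1 / 16 : ℝ) ≤ j + 1 := by
    calc (N : ℝ) ^ (1 / 16 : ℝ) ≤ ((j + 1 : ℝ) ^ 16) ^ (1 / 16 : ℝ) := by gcongr
      _ = j + 1 := by
        rw [← Real.rpow_natCast, ← Real.rpow_mul (by positivity)]
        norm_num
  have h2 : 0 < (N : ℝ) ^ (1 / 16 : ℝ) := by positivity
  rw [Real.rpow_neg hN.le, ← div_eq_mul_inv, div_le_div_iff₀ (by positivity) h2]
  linarith

theorem ae_exists_abs_closePairs_sub_le :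
    ∀ᵐ t : UnitAddCircle, ∃ N₀ : ℕ, ∀ N : ℕ, N₀ ≤ N → ∀ δ : ℝ, 0 < δ → δ ≤ 1 / 4 →
      1 ≤ δ * (N * Real.log N) →
      |closePairs N δ t - 2 * δ * (N : ℝ) ^ 2| ≤
        2 ^ 41 * ((N : ℝ) ^ 2 * δ) * (N : ℝ) ^ (-(1 / 16) : ℝ) := by
  filter_upwards [ae_eventually_abs_closePairs_sub_le] with t ⟨J, hJ⟩
  refine ⟨(J + 2 ^ 24) ^ 16, fun N hN δ hδ0 hδ hδN => ?_⟩
  obtain ⟨j, hjN, hNj⟩ := exists_pow_le_lt_succ_pow 16 (by norm_num) N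
  have hj : J + 2 ^ 24 ≤ j := by
    have := (Nat.pow_lt_pow_iff_left (by norm_num)).1 (hN.trans_lt hNj)
    omega
  have hjJ : J ≤ j := by omega
  have hj24 : 2 ^ 24 ≤ j := by omega
  have hj1 : 1 ≤ j := by omega
  have hj1R : (1 : ℝ) ≤ j := by exact_mod_cast hj1
  have hN0 : (0 : ℝ) < N := by
    exact_mod_cast (lt_of_lt_of_le (pow_pos (by omega : 0 < j) 16) hjN)
  have hNy : (N : ℝ) ≤ (j + 1 : ℝ) ^ 16 := by exact_mod_cast hNj.le
  have hlog : Real.log N ≤ 16 * j := by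
    calc Real.log N ≤ Real.log ((j + 1 : ℝ) ^ 16) := Real.log_le_log hN0 hNy
      _ = 16 * Real.log (j + 1) := by rw [Real.log_pow]; norm_num
      _ ≤ 16 * j := by
        have := Real.log_le_sub_one_of_pos (show (0 : ℝ) < j + 1 by linarith)
        linarith
  have hδj : 1 ≤ 16 * δ * (j + 1 : ℝ) ^ 16 * j := by
    calc 1 ≤ δ * (N * Real.log N) := hδN
      _ ≤ δ * ((j + 1 : ℝ) ^ 16 * (16 * j)) := by gcongr
      _ = _ := by ring
  have hup := closePairs_le_of_grid t j N δ hj1 hNj hjN hδ0 hδ hδj (by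
    intro i hi hi2
    have := hJ (j + 1) (by omega) i hi hi2
    push_cast at this
    exact this)
  have hlo := le_closePairs_of_grid t j N δ hj24 hNj hjN hδ0 hδ hδj (hJ j hjJ)
  have hroot := one_div_le_two_mul_rpow_neg (by omega) hN0 hNy
  have hmain : |closePairs N δ t - 2 * δ * (N : ℝ) ^ 2| ≤
      (N : ℝ) ^ 2 * δ * (2 ^ 40 * (1 / j)) := by
    rw [abs_le]
    constructor <;> linarith
  refine hmain.trans ?_
  linarith [mul_le_mul_of_nonneg_left hroot
    (mul_nonneg (mul_nonneg (sq_nonneg (N : ℝ)) hδ0.le) (by norm_num : (0 : ℝ) ≤ 2 ^ 40))]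

theorem R2_eq_closePairs (α L : ℝ) (N : ℕ) (s : ℝ) :
    R2 α L N s = 1 / N * closePairs N (s * L / N) (α : UnitAddCircle) := by
  have h : ∀ p : ℕ × ℕ, arc (s * L / N) (sqDiff p • (α : UnitAddCircle)) =
      if |sfrac (α * ((p.1 : ℝ) ^ 2 - (p.2 : ℝ) ^ 2))| ≤ s * L / N then 1 else 0 := by
    intro p
    have e : sqDiff p • (α : UnitAddCircle) =
        ((α * ((p.1 : ℝ) ^ 2 - (p.2 : ℝ) ^ 2) : ℝ) : UnitAddCircle) := by
      rw [← AddCircle.coe_zsmul, zsmul_eq_mul, sqDiff]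
      push_cast
      rw [mul_comm]
    rw [arc_apply, abs_sfrac_eq_norm, e]
  rw [R2, closePairs, Finset.sum_congr rfl fun p _ => h p, Finset.sum_boole, distinctPairs,
    Finset.filter_filter]

theorem ae_restrict_Icc_of_ae_unitAddCircle {P : UnitAddCircle → Prop}
    (h : ∀ᵐ t : UnitAddCircle, P t) :
    ∀ᵐ α : ℝ ∂(volume.restrict (Set.Icc (0 : ℝ) 1)), P α := by
  have h1 := (UnitAddCircle.measurePreserving_mk 0).quasiMeasurePreserving.ae h
  rwa [zero_add, restrict_Ioc_eq_restrict_Icc] at h1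

theorem exists_log_mul_rpow_neg_le (ε : ℝ) (hε : 0 < ε) :
    ∃ N₁ : ℕ, ∀ N : ℕ, N₁ ≤ N → Real.log N * (N : ℝ) ^ (-ε) ≤ 1 / 4 := by
  have h := ((isLittleO_log_rpow_atTop hε).bound (show (0 : ℝ) < 1 / 4 by norm_num))
  obtain ⟨N₁, hN₁⟩ := Filter.eventually_atTop.1 (tendsto_natCast_atTop_atTop.eventually h)
  refine ⟨N₁ + 1, fun N hN => ?_⟩
  have hb := hN₁ N (by omega)
  have hN0 : (0 : ℝ) < N := by exact_mod_cast (by omega : 0 < N)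
  have hp : 0 < (N : ℝ) ^ ε := by positivity
  rw [Real.norm_of_nonneg hp.le] at hb
  rw [Real.rpow_neg hN0.le, ← div_eq_mul_inv, div_le_iff₀ hp]
  exact (Real.le_norm_self _).trans hb

theorem pair_correlation_small_scales (ε : ℝ) (hε : ε ∈ Set.Ioo (0:ℝ) (1/4)) :
    ∀ᵐ α ∂(volume.restrict (Set.Icc (0:ℝ) 1)),
      ∃ C : ℝ, 0 < C ∧ ∀ N : ℕ, 2 ≤ N → ∀ L : ℝ, 1 ≤ L → L ≤ (N : ℝ) ^ (1 - ε) →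
        ∀ s : ℝ, 1 / Real.log N ≤ s → s ≤ Real.log N →
          |R2 α L N s - 2 * L * s| ≤ C * L * s * (N : ℝ) ^ (-ε / 13) := by
  obtain ⟨hε0, hε4⟩ := hε
  obtain ⟨N₁, hN₁⟩ := exists_log_mul_rpow_neg_le ε hε0
  filter_upwards [ae_restrict_Icc_of_ae_unitAddCircle ae_exists_abs_closePairs_sub_le]
    with α ⟨N₀, hN₀⟩
  set B : ℕ := max N₀ N₁ with hB
  refine ⟨2 ^ 41 + ((B : ℝ) ^ 2 + 2) * B, by positivity, fun N hN L hL hLN s hs hsN => ?_⟩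
  have hN2 : (2 : ℝ) ≤ N := by exact_mod_cast hN
  have hN0 : (0 : ℝ) < N := by linarith
  have hlog : 0 < Real.log N := Real.log_pos (by linarith)
  have hs0 : 0 < s := (by positivity : 0 < 1 / Real.log N).trans_le hs
  have hslog : 1 ≤ s * Real.log N := by rwa [div_le_iff₀ hlog] at hs
  have hL0 : 0 < L := by linarith
  have hLslog : 1 ≤ L * s * Real.log N := by
    rw [mul_assoc]
    exact one_le_mul_of_one_le_of_one_le hL hslog
  have hNε : 0 < (N : ℝ) ^ (-ε / 13) := by positivity
  rcases le_or_gt B N with hBN | hNB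
  · have hδ0 : 0 < s * L / N := by positivity
    have hδ : s * L / N ≤ 1 / 4 := by
      refine le_trans ?_ (hN₁ N ((le_max_right _ _).trans hBN))
      calc s * L / N ≤ Real.log N * (N : ℝ) ^ (1 - ε) / N := by gcongr
        _ = Real.log N * (N : ℝ) ^ (-ε) := by
          rw [sub_eq_add_neg, Real.rpow_add hN0, Real.rpow_one]
          field_simp
    have hδN : 1 ≤ s * L / N * (N * Real.log N) := by
      have : s * L / N * (N * Real.log N) = L * s * Real.log N := by field_simp
      rwa [this]
    have hmain := hN₀ N ((le_max_left _ _).trans hBN) _ hδ0 hδ hδN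
    have e : R2 α L N s - 2 * L * s =
        1 / N * (closePairs N (s * L / N) α - 2 * (s * L / N) * (N : ℝ) ^ 2) := by
      rw [R2_eq_closePairs]; field_simp
    rw [e, abs_mul, abs_of_pos (by positivity : (0 : ℝ) < 1 / N)]
    calc _ ≤ 1 / N * (2 ^ 41 * ((N : ℝ) ^ 2 * (s * L / N)) * (N : ℝ) ^ (-(1 / 16) : ℝ)) := by
          gcongr
      _ = 2 ^ 41 * L * s * (N : ℝ) ^ (-(1 / 16) : ℝ) := by field_simp
      _ ≤ (2 ^ 41 + ((B : ℝ) ^ 2 + 2) * B) * L * s * (N : ℝ) ^ (-ε / 13) := by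
          gcongr
          · exact le_add_of_nonneg_right (by positivity)
          · linarith
          · linarith
  · have hNBR : (N : ℝ) ≤ B := by exact_mod_cast hNB.le
    have hlogN : Real.log N ≤ N := by linarith [Real.log_le_sub_one_of_pos hN0]
    have hR : R2 α L N s ≤ N := by
      rw [R2_eq_closePairs]
      calc _ ≤ 1 / (N : ℝ) * (N : ℝ) ^ 2 := by gcongr; exact closePairs_le _ _ _
        _ = N := by field_simp
    have hR0 : 0 ≤ R2 α L N s := by
      rw [R2_eq_closePairs]; exact mul_nonneg (by positivity) (closePairs_nonneg _ _ _)
    have hNs : (N : ℝ) ≤ (B : ℝ) ^ 2 * (L * s) := by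
      calc (N : ℝ) = N * 1 := (mul_one _).symm
        _ ≤ N * (L * s * N) := by
          gcongr; exact hLslog.trans (by gcongr)
        _ = (N : ℝ) ^ 2 * (L * s) := by ring
        _ ≤ _ := by gcongr
    have hinv : 1 ≤ B * (N : ℝ) ^ (-ε / 13) := by
      calc (1 : ℝ) = N * (N : ℝ) ^ (-1 : ℝ) := by rw [Real.rpow_neg_one]; field_simp
        _ ≤ B * (N : ℝ) ^ (-ε / 13) := by gcongr <;> linarith
    calc |R2 α L N s - 2 * L * s| ≤ ((B : ℝ) ^ 2 + 2) * (L * s) := by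
          rw [abs_le]
          have : 0 < L * s := by positivity
          constructor <;> nlinarith [sq_nonneg (B : ℝ)]
      _ = ((B : ℝ) ^ 2 + 2) * (L * s) * 1 := (mul_one _).symm
      _ ≤ ((B : ℝ) ^ 2 + 2) * (L * s) * (B * (N : ℝ) ^ (-ε / 13)) := by gcongr
      _ = ((B : ℝ) ^ 2 + 2) * B * L * s * (N : ℝ) ^ (-ε / 13) := by ring
      _ ≤ _ := by gcongr; exact le_add_of_nonneg_left (by positivity)
end
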